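/- arXiv:1408.5194 — 2 statements merged into one kernel-verified Lean document; each statement's English description precedes it below -/
import Mathlib

section
/- Let ℓ be a prime and let K be a function field over an algebraically closed field k with char k ≠ ℓ and trdeg(K|k) ≥ 5. Then every element x ∈ K^× ∖ k^× that is separable in K is a product of two very general elements of K. Consequently, the group k^M_1(K) = K^×/(K^×)^ℓ is generated by the good rational subgroups of k^M_1(K). -/
/-! Common definitions: mod-ℓ Milnor K-theory, K^×/(K^×)^ℓ, Ω_K, relative algebraic
closure, transcendence degree predicates, discrete valuations, etc. -/

noncomputable section

open scoped TensorProduct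

universe u v

/-- The `n`-fold tensor power (over `ℤ`) of the multiplicative group `Kˣ`,
written additively. -/
abbrev MilnorPre (n : ℕ) (K : Type*) [Field K] : Type _ :=
  PiTensorProduct ℤ (fun _ : Fin n => Additive Kˣ)

/-- The submodule of Steinberg relations: generated by all `a₁ ⊗ ⋯ ⊗ aₙ`
with `aᵢ + aⱼ = 1` for some `i < j`. -/
def SteinbergRel (n : ℕ) (K : Type*) [Field K] : Submodule ℤ (MilnorPre n K) :=
  Submodule.span ℤ
    {x | ∃ a : Fin n → Kˣ,
      (∃ i j : Fin n, i < j ∧ ((a i : K) + (a j : K) = 1)) ∧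
        x = PiTensorProduct.tprod ℤ (fun i => Additive.ofMul (a i))}

/-- The `n`-th Milnor K-group `K^M_n(K)`: the quotient of the `n`-fold tensor
power of `K^×` by the Steinberg relations. -/
abbrev MilnorK (n : ℕ) (K : Type*) [Field K] : Type _ :=
  MilnorPre n K ⧸ SteinbergRel n K

/-- The mod-`ℓ` Milnor K-group `k^M_n(K) = K^M_n(K)/ℓ`. -/
abbrev MilnorKMod (ℓ n : ℕ) (K : Type*) [Field K] : Type _ :=
  MilnorK n K ⧸ LinearMap.range ((ℓ : ℤ) • (LinearMap.id : MilnorK n K →ₗ[ℤ] MilnorK n K))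

/-- The symbol `{a₁, …, aₙ}` in `k^M_n(K)`. -/
def milnorSymbol (ℓ : ℕ) {n : ℕ} {K : Type*} [Field K] (a : Fin n → Kˣ) :
    MilnorKMod ℓ n K :=
  Submodule.Quotient.mk (Submodule.Quotient.mk
    (PiTensorProduct.tprod ℤ (fun i => Additive.ofMul (a i))))

/-- `k^M_1(K) = K^×/(K^×)^ℓ`, written multiplicatively. -/
abbrev K1 (ℓ : ℕ) (K : Type*) [Field K] : Type _ :=
  Kˣ ⧸ (powMonoidHom ℓ : Kˣ →* Kˣ).range

/-- The projection `K^× → K^×/(K^×)^ℓ`. -/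
def K1proj (ℓ : ℕ) (K : Type*) [Field K] : Kˣ →* K1 ℓ K :=
  QuotientGroup.mk' _

/-- The subgroup of `Kˣ` consisting of the units lying in an intermediate field `L`. -/
def fieldUnits {k K : Type*} [Field k] [Field K] [Algebra k K]
    (L : IntermediateField k K) : Subgroup Kˣ where
  carrier := {x : Kˣ | (x : K) ∈ L}
  one_mem' := by simpa using one_mem L
  mul_mem' := by
    intro a b ha hb
    simpa using mul_mem ha hb
  inv_mem' := by
    intro a ha
    simpa using inv_mem (show (a : K) ∈ L from ha)

/-- `Ω_K(L)`: the image of `L^×` in `K^×/(K^×)^ℓ`. -/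
def Omega (ℓ : ℕ) {k K : Type*} [Field k] [Field K] [Algebra k K]
    (L : IntermediateField k K) : Subgroup (K1 ℓ K) :=
  (fieldUnits L).map (K1proj ℓ K)

/-- A subextension `L` of `K|k` is relatively algebraically closed in `K` if every
element of `K` algebraic over `L` lies in `L`. -/
def RelAlgClosed {k K : Type*} [Field k] [Field K] [Algebra k K]
    (L : IntermediateField k K) : Prop :=
  ∀ x : K, IsAlgebraic L x → x ∈ L

/-- `K` is a function field over `k`: a finitely generated field extension. -/
def IsFunctionField (k K : Type*) [Field k] [Field K] [Algebra k K] : Prop :=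
  ∃ s : Finset K, IntermediateField.adjoin k (s : Set K) = ⊤

/-- `trdeg(K|k) = d`: there is a transcendence basis indexed by `Fin d`. -/
def HasTrdeg (k : Type*) (K : Type*) [Field k] [Field K] [Algebra k K] (d : ℕ) : Prop :=
  ∃ x : Fin d → K, IsTranscendenceBasis k x

/-- `trdeg(K|k) ≥ m`: there are `m` algebraically independent elements. -/
def TrdegGe (k : Type*) (K : Type*) [Field k] [Field K] [Algebra k K] (m : ℕ) : Prop :=
  ∃ x : Fin m → K, AlgebraicIndependent k x

/-- `dim^M_K(S) ≥ d` for a subset `S ⊆ k^M_1(K)`: there are `s₁, …, s_d ∈ S` with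
`{s₁, …, s_d} ≠ 0` in `k^M_d(K)`. -/
def dimMge (ℓ : ℕ) {K : Type*} [Field K] (S : Set (K1 ℓ K)) (d : ℕ) : Prop :=
  ∃ a : Fin d → Kˣ, (∀ i, K1proj ℓ K (a i) ∈ S) ∧ milnorSymbol ℓ a ≠ 0

/-- `dim^M_K(S) = r`. -/
def dimMeq (ℓ : ℕ) {K : Type*} [Field K] (S : Set (K1 ℓ K)) (r : ℕ) : Prop :=
  dimMge ℓ S r ∧ ¬ dimMge ℓ S (r + 1)

/-- `t` is a general element of `K` over `k`: `t ∉ k` and `k(t)` is relatively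
algebraically closed in `K`. -/
def IsGeneralElement (k : Type*) {K : Type*} [Field k] [Field K] [Algebra k K] (t : K) : Prop :=
  t ∉ (⊥ : IntermediateField k K) ∧ RelAlgClosed (IntermediateField.adjoin k {t})

/-- A rational subgroup of `k^M_1(K)`: `Ω_K(k(t))` for a general element `t`. -/
def IsRationalSubgroup (ℓ : ℕ) (k : Type*) {K : Type*} [Field k] [Field K] [Algebra k K]
    (A : Subgroup (K1 ℓ K)) : Prop :=
  ∃ t : K, IsGeneralElement k t ∧ A = Omega ℓ (IntermediateField.adjoin k {t})

/-- `𝔊^r(K|k)`: the subgroups `Ω_K(L)` for `L` relatively algebraically closed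
in `K` of transcendence degree `r` over `k`. -/
def GSet (ℓ : ℕ) (k : Type*) {K : Type*} [Field k] [Field K] [Algebra k K] (r : ℕ) :
    Set (Subgroup (K1 ℓ K)) :=
  {A | ∃ L : IntermediateField k K, RelAlgClosed L ∧ HasTrdeg k L r ∧ A = Omega ℓ L}

/-- `𝔐^1(K)`: subgroups maximal among the subgroups `B` of `k^M_1(K)`
with `dim^M_K(B) = 1`. -/
def M1Set (ℓ : ℕ) (K : Type*) [Field K] : Set (Subgroup (K1 ℓ K)) :=
  {A | dimMeq ℓ (A : Set (K1 ℓ K)) 1 ∧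
    ∀ B : Subgroup (K1 ℓ K), dimMeq ℓ (B : Set (K1 ℓ K)) 1 → A ≤ B → B = A}

/-- Condition (a) and (b) of the maximality characterization of `𝔊^r`:
`B` is generated by rational subgroups and `dim^M_K(B) = r`. -/
def SpannedByRatWithDim (ℓ : ℕ) (k : Type*) {K : Type*} [Field k] [Field K] [Algebra k K]
    (r : ℕ) (B : Subgroup (K1 ℓ K)) : Prop :=
  (∃ S : Set (Subgroup (K1 ℓ K)), (∀ T ∈ S, IsRationalSubgroup ℓ k T) ∧ B = sSup S) ∧
    dimMeq ℓ (B : Set (K1 ℓ K)) r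

/-- A discrete valuation of a field `F`: a surjective homomorphism `F^× → ℤ`
satisfying the ultrametric inequality. -/
structure DiscreteValuation (F : Type*) [Field F] where
  v : Fˣ → ℤ
  map_mul' : ∀ x y : Fˣ, v (x * y) = v x + v y
  surjective' : Function.Surjective v
  min_le' : ∀ x y z : Fˣ, (x : F) + (y : F) = (z : F) → min (v x) (v y) ≤ v z

lemma DiscreteValuation.v_one {F : Type*} [Field F] (w : DiscreteValuation F) : w.v 1 = 0 := by
  have h := w.map_mul' 1 1
  simp only [mul_one] at h
  omega

/-- A discrete valuation of `F` is trivial on the base field `k`. -/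
def DiscreteValuation.TrivialOn (k : Type*) {F : Type*} [Field k] [Field F] [Algebra k F]
    (w : DiscreteValuation F) : Prop :=
  ∀ (c : k) (hc : algebraMap k F c ≠ 0), w.v (Units.mk0 _ hc) = 0

/-- The unit group `U_w ⊆ F^×` of a discrete valuation. -/
def DiscreteValuation.units {F : Type*} [Field F] (w : DiscreteValuation F) : Subgroup Fˣ where
  carrier := {x : Fˣ | w.v x = 0}
  one_mem' := w.v_one
  mul_mem' := by
    intro a b ha hb
    have h := w.map_mul' a b
    simp only [Set.mem_setOf_eq] at ha hb ⊢
    omega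
  inv_mem' := by
    intro a ha
    have h := w.map_mul' a a⁻¹
    rw [mul_inv_cancel] at h
    have h1 := w.v_one
    simp only [Set.mem_setOf_eq] at ha ⊢
    omega

/-- `𝔘_v`: the image of the unit group `U_v` in `K^×/(K^×)^ℓ`. -/
def DiscreteValuation.unitsImage (ℓ : ℕ) {F : Type*} [Field F] (w : DiscreteValuation F) :
    Subgroup (K1 ℓ F) :=
  w.units.map (K1proj ℓ F)

/-- For a discrete valuation `w` of an intermediate field `F` of `K|k`, the image of
the unit group `U_w` in `K^×/(K^×)^ℓ`. -/
def unitsImageIn (ℓ : ℕ) {k K : Type*} [Field k] [Field K] [Algebra k K]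
    (F : IntermediateField k K) (w : DiscreteValuation F) : Subgroup (K1 ℓ K) :=
  (w.units.map (Units.map (algebraMap F K).toMonoidHom)).map (K1proj ℓ K)

/-- The residue field of `v` has transcendence degree `≥ m` over `k`: there are
`v`-units `x₁, …, x_m` whose residues are algebraically independent over `k`,
expressed by saying that every nonzero polynomial over `k` evaluated at the `xᵢ`
is a unit of value `0`. -/
def DiscreteValuation.ResidueTrdegGe (k : Type*) {K : Type*} [Field k] [Field K] [Algebra k K]
    (v : DiscreteValuation K) (m : ℕ) : Prop :=
  ∃ x : Fin m → Kˣ, (∀ i, v.v (x i) = 0) ∧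
    ∀ P : MvPolynomial (Fin m) k, P ≠ 0 →
      ∃ u : Kˣ, (u : K) = MvPolynomial.aeval (fun i => ((x i : K))) P ∧ v.v u = 0

/-- A divisorial-type valuation of `K|k` (where `d = trdeg(K|k)`): a discrete valuation
trivial on `k` whose residue field has transcendence degree exactly `d - 1` over `k`. -/
def IsDivisorialType (k : Type*) {K : Type*} [Field k] [Field K] [Algebra k K] (d : ℕ)
    (v : DiscreteValuation K) : Prop :=
  v.TrivialOn k ∧ v.ResidueTrdegGe k (d - 1) ∧ ¬ v.ResidueTrdegGe k d

/-- `Δ_A`: the set of subgroups `A ⊓ 𝔘_v`, for `v` ranging over the divisorial-type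
valuations of `K` with `A ⊄ 𝔘_v`. -/
def DeltaA (ℓ : ℕ) (k : Type*) {K : Type*} [Field k] [Field K] [Algebra k K] (d : ℕ)
    (A : Subgroup (K1 ℓ K)) : Set (Subgroup (K1 ℓ K)) :=
  {T | ∃ v : DiscreteValuation K, IsDivisorialType k d v ∧
    ¬ A ≤ v.unitsImage ℓ ∧ T = A ⊓ v.unitsImage ℓ}

/-- A good rational subgroup: a rational subgroup `A = Ω_K(k(t))` such that for every
discrete valuation `w` of `k(t)` trivial on `k`, the image of `U_w` in `K^×/(K^×)^ℓ`
belongs to `Δ_A`. -/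
def IsGoodRationalSubgroup (ℓ : ℕ) (k : Type*) {K : Type*} [Field k] [Field K] [Algebra k K]
    (d : ℕ) (A : Subgroup (K1 ℓ K)) : Prop :=
  ∃ t : K, IsGeneralElement k t ∧ A = Omega ℓ (IntermediateField.adjoin k {t}) ∧
    ∀ w : DiscreteValuation (IntermediateField.adjoin k {t}), w.TrivialOn k →
      unitsImageIn ℓ (IntermediateField.adjoin k {t}) w ∈ DeltaA ℓ k d A

/-- A very general element: a general element `t` such that `Ω_K(k(t))` is a good
rational subgroup. -/
def IsVeryGeneral (ℓ : ℕ) (k : Type*) {K : Type*} [Field k] [Field K] [Algebra k K]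
    (d : ℕ) (t : K) : Prop :=
  IsGeneralElement k t ∧ IsGoodRationalSubgroup ℓ k d (Omega ℓ (IntermediateField.adjoin k {t}))

/-- `x` is separable in `K`: in characteristic `p > 0`, `x` is not a `p`-th power;
in characteristic `0` every element is separable. -/
def IsSeparableIn (K : Type*) [Field K] (x : K) : Prop :=
  ∀ p : ℕ, p.Prime → CharP K p → ¬ ∃ y : K, y ^ p = x

/-- A perfect closure of `K`: a perfect field which is a purely inseparable
extension of `K`. -/
structure PerfectClosureOf (K : Type u) [Field K] : Type (u + 1) where
  carrier : Type u
  [fieldInst : Field carrier]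
  [algebraInst : Algebra K carrier]
  purelyInseparable : IsPurelyInseparable K carrier
  perfect : PerfectField carrier

attribute [instance] PerfectClosureOf.fieldInst PerfectClosureOf.algebraInst

/-- A group isomorphism `φ : k^M_1(K) → k^M_1(L)` is induced by a field isomorphism
`σ : K^i → L^i` of the perfect closures, via the canonical identifications
`k^M_1(K) ≅ k^M_1(K^i)` and `k^M_1(L) ≅ k^M_1(L^i)`. -/
def InducesOnK1 (ℓ : ℕ) {K : Type u} {L : Type v} [Field K] [Field L]
    (PK : PerfectClosureOf K) (PL : PerfectClosureOf L)
    (σ : PK.carrier ≃+* PL.carrier) (φ : K1 ℓ K ≃* K1 ℓ L) : Prop :=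
  ∀ (x : Kˣ) (y : Lˣ),
    (φ (K1proj ℓ K x) = K1proj ℓ L y ↔
      ∃ z : (PL.carrier)ˣ,
        Units.map σ.toRingHom.toMonoidHom
            (Units.map (algebraMap K PK.carrier).toMonoidHom x) =
          Units.map (algebraMap L PL.carrier).toMonoidHom y * z ^ ℓ)

/-- `φ : k^M_1(K) → k^M_1(L)` is compatible with `k^M_2`: `φ ⊗ φ` descends, along the
multiplication maps, to an isomorphism `k^M_2(K) → k^M_2(L)`; equivalently, there is an
additive isomorphism `k^M_2(K) ≃ k^M_2(L)` carrying `{a, b}` to `{a', b'}` whenever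
`φ` carries the class of `a` (resp. `b`) to the class of `a'` (resp. `b'`). -/
def CompatWithK2 (ℓ : ℕ) {K L : Type*} [Field K] [Field L] (φ : K1 ℓ K ≃* K1 ℓ L) : Prop :=
  ∃ ψ : MilnorKMod ℓ 2 K ≃+ MilnorKMod ℓ 2 L,
    ∀ (a b : Kˣ) (a' b' : Lˣ),
      φ (K1proj ℓ K a) = K1proj ℓ L a' → φ (K1proj ℓ K b) = K1proj ℓ L b' →
        ψ (milnorSymbol ℓ ![a, b]) = milnorSymbol ℓ ![a', b']

/-- `φ : k^M_1(K) → k^M_1(L)` is compatible with `𝔊^1_rat`: it maps rational subgroups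
bijectively onto rational subgroups. -/
def CompatWithRat (ℓ : ℕ) (k : Type*) (l : Type*) {K L : Type*}
    [Field k] [Field K] [Algebra k K] [Field l] [Field L] [Algebra l L]
    (φ : K1 ℓ K ≃* K1 ℓ L) : Prop :=
  (∀ A : Subgroup (K1 ℓ K), IsRationalSubgroup ℓ k A →
     IsRationalSubgroup ℓ l (A.map φ.toMonoidHom)) ∧
  (∀ B : Subgroup (K1 ℓ L), IsRationalSubgroup ℓ l B →
     ∃ A : Subgroup (K1 ℓ K), IsRationalSubgroup ℓ k A ∧ A.map φ.toMonoidHom = B)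

/-- Two isomorphisms of perfect closures differ by a power of the Frobenius
(in characteristic `0`, they are equal). -/
def FrobTwistEquiv {Ki Li : Type*} [Field Ki] [Field Li] (σ σ' : Ki ≃+* Li) : Prop :=
  σ = σ' ∨ ∃ p : ℕ, p.Prime ∧ CharP Ki p ∧
    ((∃ n : ℕ, ∀ x, σ' x = σ (x ^ p ^ n)) ∨ (∃ n : ℕ, ∀ x, σ x = σ' (x ^ p ^ n)))

open scoped IntermediateField

namespace DiscreteValuation

variable {F : Type*} [Field F] (v : DiscreteValuation F)

open Classical in
/-- The valuation as a function on the whole field, with the junk value `0` at `0`. -/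
def val (x : F) : ℤ := if h : x ≠ 0 then v.v (Units.mk0 x h) else 0

lemma val_of_ne {x : F} (h : x ≠ 0) : v.val x = v.v (Units.mk0 x h) := dif_pos h

@[simp] lemma val_units (x : Fˣ) : v.val (x : F) = v.v x := by
  rw [v.val_of_ne x.ne_zero]; simp

@[simp] lemma val_one : v.val 1 = 0 := by
  simpa [v.v_one] using v.val_units 1

lemma val_mul {x y : F} (hx : x ≠ 0) (hy : y ≠ 0) : v.val (x * y) = v.val x + v.val y := by
  rw [v.val_of_ne hx, v.val_of_ne hy, v.val_of_ne (mul_ne_zero hx hy), ← v.map_mul']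
  congr 1
  ext; simp

lemma val_inv {x : F} (hx : x ≠ 0) : v.val x⁻¹ = - v.val x := by
  have := v.val_mul hx (inv_ne_zero hx)
  rw [mul_inv_cancel₀ hx, val_one] at this
  omega

lemma val_div {x y : F} (hx : x ≠ 0) (hy : y ≠ 0) : v.val (x / y) = v.val x - v.val y := by
  rw [div_eq_mul_inv, v.val_mul hx (inv_ne_zero hy), v.val_inv hy]; ring

lemma val_pow {x : F} (hx : x ≠ 0) (n : ℕ) : v.val (x ^ n) = n * v.val x := by
  induction n with
  | zero => simp
  | succ n ih => rw [pow_succ, v.val_mul (pow_ne_zero n hx) hx, ih]; push_cast; ring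

lemma min_le_val_add {x y : F} (hx : x ≠ 0) (hy : y ≠ 0) (hxy : x + y ≠ 0) :
    min (v.val x) (v.val y) ≤ v.val (x + y) := by
  rw [v.val_of_ne hx, v.val_of_ne hy, v.val_of_ne hxy]
  exact v.min_le' _ _ _ (by simp)

lemma val_neg_one : v.val (-1) = 0 := by
  have h : (-1 : F) ≠ 0 := neg_ne_zero.mpr one_ne_zero
  have := v.val_mul h h
  rw [neg_one_mul, neg_neg, val_one] at this
  omega

lemma val_neg (x : F) : v.val (-x) = v.val x := by
  by_cases hx : x = 0
  · simp [hx]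
  · rw [← neg_one_mul, v.val_mul (neg_ne_zero.mpr one_ne_zero) hx, v.val_neg_one, zero_add]

lemma val_add_of_lt {x y : F} (hx : x ≠ 0) (hy : y ≠ 0) (h : v.val x < v.val y) :
    x + y ≠ 0 ∧ v.val (x + y) = v.val x := by
  have hxy : x + y ≠ 0 := by
    intro h0
    rw [eq_neg_of_add_eq_zero_left h0, val_neg] at h
    exact lt_irrefl _ h
  refine ⟨hxy, le_antisymm ?_ ?_⟩
  · have := v.min_le_val_add hxy (neg_ne_zero.mpr hy) (by simpa using hx)
    rw [add_neg_cancel_right, val_neg] at this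
    omega
  · have := v.min_le_val_add hx hy hxy
    omega

lemma exists_val_eq (n : ℤ) : ∃ x : F, x ≠ 0 ∧ v.val x = n := by
  obtain ⟨x, hx⟩ := v.surjective' n
  exact ⟨x, x.ne_zero, by rw [val_units, hx]⟩

lemma val_multiset_prod (s : Multiset F) (hs : ∀ a ∈ s, a ≠ 0) :
    v.val s.prod = (s.map v.val).sum := by
  induction s using Multiset.induction_on with
  | empty => simp
  | cons a s ih =>
    have hs' : ∀ b ∈ s, b ≠ 0 := fun b hb => hs b (Multiset.mem_cons_of_mem hb)
    rw [Multiset.prod_cons, Multiset.map_cons, Multiset.sum_cons,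
      v.val_mul (hs a (Multiset.mem_cons_self a s)) (Multiset.prod_ne_zero fun h => hs' 0 h rfl),
      ih hs']

lemma TrivialOn.val_eq {k : Type*} [Field k] [Algebra k F] {v : DiscreteValuation F}
    (h : v.TrivialOn k) (c : k) : v.val (algebraMap k F c) = 0 := by
  by_cases hc : algebraMap k F c = 0
  · simp [hc, val]
  · rw [v.val_of_ne hc]; exact h c hc

end DiscreteValuation

section places

variable {k F : Type*} [Field k] [IsAlgClosed k] [Field F] [Algebra k F]

lemma transcendental_of_notMem_bot {u : F} (hu : u ∉ (⊥ : IntermediateField k F)) :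
    Transcendental k u := by
  intro h
  apply hu
  have : Algebra.IsIntegral k k⟮u⟯ :=
    ⟨fun z => ((IntermediateField.isAlgebraic_adjoin_simple h.isIntegral).isAlgebraic z).isIntegral⟩
  obtain ⟨c, hc⟩ := (IsAlgClosed.algebraMap_bijective_of_isIntegral (k := k) (K := k⟮u⟯))
    |>.2 ⟨u, IntermediateField.mem_adjoin_simple_self k u⟩
  exact ⟨c, congrArg Subtype.val hc⟩

lemma aeval_eq_prod_roots (u : F) (P : Polynomial k) :
    Polynomial.aeval u P = algebraMap k F P.leadingCoeff *
      (P.roots.map fun a => u - algebraMap k F a).prod := by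
  conv_lhs => rw [(IsAlgClosed.splits P).eq_prod_roots]
  simp [map_multiset_prod, Multiset.map_map]

lemma DiscreteValuation.TrivialOn.val_aeval {w : DiscreteValuation F} (hw : w.TrivialOn k) {u : F}
    (hu : u ∉ (⊥ : IntermediateField k F)) {P : Polynomial k} (hP : P ≠ 0) :
    w.val (Polynomial.aeval u P) = (P.roots.map fun a => w.val (u - algebraMap k F a)).sum := by
  have h1 : ∀ a : k, u - algebraMap k F a ≠ 0 := fun a h => hu ⟨a, (sub_eq_zero.mp h).symm⟩
  rw [aeval_eq_prod_roots, w.val_mul, hw.val_eq, zero_add, w.val_multiset_prod, Multiset.map_map]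
  · rfl
  · intro a ha
    obtain ⟨b, -, rfl⟩ := Multiset.mem_map.mp ha
    exact h1 b
  · simpa using hP
  · apply Multiset.prod_ne_zero
    intro h
    obtain ⟨b, -, hb⟩ := Multiset.mem_map.mp h
    exact h1 b hb

/-- Two valuations that are proportional on the linear polynomials in `u` are proportional
on `k(u)`. -/
lemma val_eq_mul_of_linear {K : Type*} [Field K] [Algebra k K] {u : K}
    (hu : u ∉ (⊥ : IntermediateField k K)) {w : DiscreteValuation k⟮u⟯} (hw : w.TrivialOn k)
    {v : DiscreteValuation K} (hv : v.TrivialOn k) (e : ℤ)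
    (h : ∀ a : k, w.val (IntermediateField.AdjoinSimple.gen k u - algebraMap k _ a) =
      e * v.val (u - algebraMap k K a)) (f : k⟮u⟯) (hf : f ≠ 0) :
    w.val f = e * v.val (f : K) := by
  set g := IntermediateField.AdjoinSimple.gen k u with hg
  have hgu : algebraMap k⟮u⟯ K g = u := IntermediateField.AdjoinSimple.algebraMap_gen k u
  have hg' : g ∉ (⊥ : IntermediateField k k⟮u⟯) := by
    rintro ⟨a, ha⟩
    exact hu ⟨a, by rw [← hgu]; exact congrArg (algebraMap k⟮u⟯ K) ha⟩
  have hpol : ∀ P : Polynomial k, P ≠ 0 →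
      w.val (Polynomial.aeval g P) = e * v.val (Polynomial.aeval u P) := by
    intro P hP
    rw [hw.val_aeval hg' hP, hv.val_aeval hu hP]
    simp_rw [h]
    exact Multiset.sum_map_mul_left
  obtain ⟨r, s, hrs⟩ := IntermediateField.mem_adjoin_simple_iff k (f : K) |>.mp f.2
  have hf0 : (f : K) ≠ 0 := by simpa using hf
  have hr : r ≠ 0 := by rintro rfl; simp [hrs] at hf0
  have hs : s ≠ 0 := by rintro rfl; simp [hrs] at hf0
  have hau : ∀ P : Polynomial k, ((Polynomial.aeval g P : k⟮u⟯) : K) = Polynomial.aeval u P := by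
    intro P
    have h1 := Polynomial.aeval_algebraMap_apply K g P
    rw [hgu] at h1
    exact h1.symm
  have hne : ∀ P : Polynomial k, P ≠ 0 → Polynomial.aeval u P ≠ 0 := fun P hP h0 =>
    transcendental_of_notMem_bot hu ⟨P, hP, h0⟩
  have hne' : ∀ P : Polynomial k, P ≠ 0 → Polynomial.aeval g P ≠ 0 := fun P hP h0 =>
    transcendental_of_notMem_bot hg' ⟨P, hP, h0⟩
  have hfe : f = Polynomial.aeval g r / Polynomial.aeval g s := by
    apply Subtype.ext
    rw [IntermediateField.coe_div, hau, hau, hrs]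
  rw [hrs, v.val_div (hne r hr) (hne s hs), hfe, w.val_div (hne' r hr) (hne' s hs),
    hpol r hr, hpol s hs]
  ring

end places

section divisorial

variable {k K : Type*} [Field k] [Field K] [Algebra k K]

lemma DiscreteValuation.aeval_uniformizer {v : DiscreteValuation K} (A : Subalgebra k K)
    (hA : ∀ a ∈ A, v.val a = 0) {π : K} (hπ0 : π ≠ 0) (hπ : v.val π = 1) (q : Polynomial A)
    (hq : q ≠ 0) : Polynomial.aeval π q ≠ 0 ∧ 0 ≤ v.val (Polynomial.aeval π q) := by
  induction hn : q.natDegree using Nat.strong_induction_on generalizing q with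
  | _ n ih =>
    subst hn
    have hsum : Polynomial.aeval π q =
        π * Polynomial.aeval π q.divX + ((q.coeff 0 : A) : K) := by
      have h := congrArg (Polynomial.aeval π) q.divX_mul_X_add
      rw [← h, map_add, map_mul, Polynomial.aeval_X, Polynomial.aeval_C, mul_comm]
      rfl
    by_cases hd : q.divX = 0
    · have h0 : q.coeff 0 ≠ 0 := by
        intro h0
        apply hq
        rw [← q.divX_mul_X_add, hd, h0]; simp
      rw [hsum, hd]
      simpa [hA _ (q.coeff 0).2] using h0
    · have hlt : q.divX.natDegree < q.natDegree := by
        rw [Polynomial.natDegree_divX_eq_natDegree_tsub_one]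
        have : q.natDegree ≠ 0 := fun h => hd (by
          rw [Polynomial.divX_eq_zero_iff]; exact Polynomial.eq_C_of_natDegree_eq_zero h)
        omega
      obtain ⟨h1, h2⟩ := ih _ hlt q.divX hd rfl
      have h3 : v.val (π * Polynomial.aeval π q.divX) = 1 + v.val (Polynomial.aeval π q.divX) := by
        rw [v.val_mul hπ0 h1, hπ]
      by_cases h0 : q.coeff 0 = 0
      · rw [hsum, h0]
        simp only [ZeroMemClass.coe_zero, add_zero]
        exact ⟨mul_ne_zero hπ0 h1, by omega⟩
      · rw [hsum, add_comm]
        have h0' : ((q.coeff 0 : A) : K) ≠ 0 := by simpa using h0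
        obtain ⟨h4, h5⟩ := v.val_add_of_lt h0' (mul_ne_zero hπ0 h1) (by
          rw [hA _ (q.coeff 0).2]; omega)
        exact ⟨h4, by rw [h5, hA _ (q.coeff 0).2]⟩

lemma DiscreteValuation.not_residueTrdegGe {d : ℕ} (hd : HasTrdeg k K d)
    (v : DiscreteValuation K) : ¬ v.ResidueTrdegGe k d := by
  rintro ⟨x, hx, hP⟩
  have hind : AlgebraicIndependent k (fun i => (x i : K)) := by
    rw [algebraicIndependent_iff]
    intro P h0
    by_contra hP0
    obtain ⟨u, hu, -⟩ := hP P hP0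
    exact u.ne_zero (hu.trans h0)
  obtain ⟨b, hb⟩ := hd
  have hbasis : IsTranscendenceBasis k (fun i => (x i : K)) := by
    apply hind.isTranscendenceBasis_of_lift_trdeg_le_of_finite
    rw [← hb.lift_cardinalMk_eq_trdeg]
  obtain ⟨π, hπ0, hπ⟩ := v.exists_val_eq 1
  have halg := hbasis.isAlgebraic.isAlgebraic π
  obtain ⟨q, hq, hq0⟩ := halg
  refine (DiscreteValuation.aeval_uniformizer (v := v) _ ?_ hπ0 hπ q hq).1 hq0
  intro a ha
  rw [Algebra.adjoin_range_eq_range_aeval] at ha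
  obtain ⟨P, rfl⟩ := ha
  by_cases hP0 : P = 0
  · simp [hP0, DiscreteValuation.val]
  · obtain ⟨u, hu, hu0⟩ := hP P hP0
    change v.val (MvPolynomial.aeval _ P) = 0
    rw [← hu, v.val_units, hu0]

/-- A discrete valuation trivial on a subfield of transcendence degree `d - 1` is of divisorial
type. -/
lemma isDivisorialType_of_trivial {d : ℕ} (hd : HasTrdeg k K d) (v : DiscreteValuation K)
    (C : IntermediateField k K) (hC : ∀ a ∈ C, v.val a = 0) (x : Fin (d - 1) → K)
    (hxC : ∀ i, x i ∈ C) (hx : AlgebraicIndependent k x) : IsDivisorialType k d v := by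
  refine ⟨fun c hc => ?_, ?_, v.not_residueTrdegGe hd⟩
  · rw [← v.val_of_ne hc]
    exact hC _ (C.algebraMap_mem c)
  · refine ⟨fun i => Units.mk0 (x i) (hx.ne_zero i), fun i => ?_, fun P hP => ?_⟩
    · rw [← v.val_of_ne]; exact hC _ (hxC i)
    · have h0 : MvPolynomial.aeval x P ≠ 0 := fun h => hP ((algebraicIndependent_iff.mp hx) P h)
      refine ⟨Units.mk0 _ h0, by simp, ?_⟩
      rw [← v.val_of_ne]
      apply hC
      have hle : Algebra.adjoin k (Set.range x) ≤ C.toSubalgebra :=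
        Algebra.adjoin_le (Set.range_subset_iff.mpr hxC)
      exact hle (by rw [Algebra.adjoin_range_eq_range_aeval]; exact ⟨P, rfl⟩)

end divisorial

section good

variable {k K : Type*} [Field k] [Field K] [Algebra k K]

/-- If a discrete valuation of `K` restricts to the discrete valuation `w` of `L`, then its unit
group cuts out the image of the unit group of `w`. -/
lemma unitsImageIn_mem_deltaA {ℓ d : ℕ} (hℓ : ℓ.Prime) (L : IntermediateField k K)
    (w : DiscreteValuation L) (v : DiscreteValuation K) (hv : IsDivisorialType k d v)
    (h : ∀ f : L, f ≠ 0 → w.val f = v.val (f : K)) :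
    unitsImageIn ℓ L w ∈ DeltaA ℓ k d (Omega ℓ L) := by
  have key : ∀ a : Kˣ, K1proj ℓ K a ∈ v.unitsImage ℓ → (ℓ : ℤ) ∣ v.val (a : K) := by
    rintro a ⟨b, hb, hab⟩
    obtain ⟨c, hc⟩ := (QuotientGroup.eq (s := (powMonoidHom ℓ : Kˣ →* Kˣ).range)).mp hab
    have hc' : a = b * c ^ ℓ := by
      rw [eq_comm, ← eq_inv_mul_iff_mul_eq]; exact hc
    have hb' : v.v b = 0 := hb
    rw [hc', Units.val_mul, v.val_mul b.ne_zero (c ^ ℓ).ne_zero, v.val_units, hb', zero_add,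
      Units.val_pow_eq_pow_val, v.val_pow c.ne_zero]
    exact dvd_mul_right _ _
  refine ⟨v, hv, fun hle => ?_, ?_⟩
  · obtain ⟨f, hf0, hf⟩ := w.exists_val_eq 1
    have hf0' : (f : K) ≠ 0 := by simpa using hf0
    have := key (Units.mk0 (f : K) hf0') (hle ⟨_, f.2, rfl⟩)
    rw [Units.val_mk0, ← h f hf0, hf] at this
    exact hℓ.one_lt.ne' (by exact_mod_cast Int.eq_one_of_dvd_one (by positivity) this)
  · ext z
    constructor
    · rintro ⟨_, ⟨f, hf, rfl⟩, rfl⟩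
      refine ⟨⟨_, (f : L).2, rfl⟩, ⟨_, ?_, rfl⟩⟩
      change v.v _ = 0
      rw [← v.val_units]
      have := h f f.ne_zero
      rw [w.val_units] at this
      exact this.symm.trans hf
    · rintro ⟨⟨a, ha, rfl⟩, hz⟩
      obtain ⟨n, hn⟩ := key a hz
      obtain ⟨g, hg0, hg⟩ := w.exists_val_eq n
      let f : L := ⟨a, ha⟩
      have hf0 : f ≠ 0 := fun h0 => a.ne_zero (congrArg Subtype.val h0)
      refine ⟨_, ⟨Units.mk0 f hf0 / Units.mk0 g hg0 ^ ℓ, ?_, rfl⟩, ?_⟩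
      · change w.v _ = 0
        rw [← w.val_units]
        push_cast
        rw [Units.val_mk0, Units.val_mk0, w.val_div hf0 (pow_ne_zero _ hg0), w.val_pow hg0, hg,
          h f hf0, sub_eq_zero]
        exact hn
      · refine (QuotientGroup.eq (s := (powMonoidHom ℓ : Kˣ →* Kˣ).range)).mpr ?_
        refine ⟨Units.map (algebraMap L K).toMonoidHom (Units.mk0 g hg0), ?_⟩
        have ha' : a = Units.map (algebraMap L K).toMonoidHom (Units.mk0 f hf0) := by
          ext; rfl
        rw [map_div, map_pow, ← ha']
        simp

lemma DiscreteValuation.TrivialOn.val_sub_eq_min {v : DiscreteValuation K} (hv : v.TrivialOn k)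
    {z : K} {a b : k} (hz : z - algebraMap k K a ≠ 0) (hab : a ≠ b)
    (hva : v.val (z - algebraMap k K a) ≠ 0) :
    v.val (z - algebraMap k K b) = min 0 (v.val (z - algebraMap k K a)) := by
  have hc : algebraMap k K (a - b) ≠ 0 := by
    rw [Ne, FaithfulSMul.algebraMap_eq_zero_iff, sub_eq_zero]; exact hab
  have hvc := hv.val_eq (a - b)
  rcases lt_or_gt_of_ne hva with hlt | hgt
  · have := (v.val_add_of_lt hz hc (by omega)).2
    rw [map_sub, sub_add_sub_cancel] at this
    omega
  · have := (v.val_add_of_lt hc hz (by omega)).2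
    rw [add_comm, map_sub, sub_add_sub_cancel] at this
    rw [map_sub] at hvc
    omega

lemma isVeryGeneral_of_places [IsAlgClosed k] {ℓ d : ℕ} (hℓ : ℓ.Prime) {u : K} (hu : IsGeneralElement k u)
    (h0 : ∀ b : k, ∃ v : DiscreteValuation K, IsDivisorialType k d v ∧
      v.val (u - algebraMap k K b) = 1)
    (hinf : ∃ v : DiscreteValuation K, IsDivisorialType k d v ∧ v.val u = -1) :
    IsVeryGeneral ℓ k d u := by
  refine ⟨hu, u, hu, rfl, fun w hw => ?_⟩
  set g := IntermediateField.AdjoinSimple.gen k u with hg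
  have hgu : algebraMap k⟮u⟯ K g = u := IntermediateField.AdjoinSimple.algebraMap_gen k u
  have hne : ∀ b : k, u - algebraMap k K b ≠ 0 := fun b h => hu.1 ⟨b, (sub_eq_zero.mp h).symm⟩
  have hneg : ∀ b : k, g - algebraMap k _ b ≠ 0 := fun b h => hne b (by
    rw [← hgu]; simpa using congrArg (algebraMap k⟮u⟯ K) h)
  have hu0 : u ≠ 0 := by simpa using hne 0
  have hg0 : g ≠ 0 := by simpa using hneg 0
  -- it suffices to find a divisorial valuation proportional to `w` on linear polynomials
  suffices ∃ (v : DiscreteValuation K) (e : ℤ), 0 ≤ e ∧ IsDivisorialType k d v ∧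
      ∀ a : k, w.val (g - algebraMap k _ a) = e * v.val (u - algebraMap k K a) by
    obtain ⟨v, e, he, hv, hve⟩ := this
    have hmul := val_eq_mul_of_linear hu.1 hw hv.1 e hve
    obtain ⟨f, hf0, hf⟩ := w.exists_val_eq 1
    have he1 : e = 1 := Int.eq_one_of_dvd_one he ⟨_, by rw [← hf]; exact hmul f hf0⟩
    refine unitsImageIn_mem_deltaA hℓ _ w v hv fun f hf => ?_
    rw [hmul f hf, he1, one_mul]
  by_cases hall : ∀ a : k, w.val (g - algebraMap k _ a) = 0
  · exfalso
    obtain ⟨v, hv, -⟩ := hinf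
    obtain ⟨f, hf0, hf⟩ := w.exists_val_eq 1
    have := val_eq_mul_of_linear hu.1 hw hv.1 0 (by simpa using hall) f hf0
    omega
  · push Not at hall
    obtain ⟨a, ha⟩ := hall
    rcases lt_or_gt_of_ne ha with hlt | hgt
    · obtain ⟨v, hv, hvu⟩ := hinf
      refine ⟨v, - w.val (g - algebraMap k _ a), by omega, hv, fun b => ?_⟩
      have h1 : v.val (u - algebraMap k K b) = -1 := by
        by_cases hb : b = 0
        · simpa [hb] using hvu
        · have := hv.1.val_sub_eq_min (hne 0) (Ne.symm hb) (by simp [hvu])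
          simp [hvu] at this
          exact this
      have h2 : w.val (g - algebraMap k _ b) = w.val (g - algebraMap k _ a) := by
        by_cases hb : a = b
        · rw [hb]
        · rw [hw.val_sub_eq_min (hneg a) hb ha]; omega
      rw [h1, h2]; ring
    · obtain ⟨v, hv, hvu⟩ := h0 a
      refine ⟨v, w.val (g - algebraMap k _ a), by omega, hv, fun b => ?_⟩
      by_cases hb : a = b
      · rw [← hb, hvu, mul_one]
      · rw [hw.val_sub_eq_min (hneg a) hb ha, hv.1.val_sub_eq_min (hne a) hb (by omega), hvu]
        simp; omega

end good

section places

open Polynomial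

/-- The discrete valuation obtained by pulling back the order of Laurent series. -/
def DiscreteValuation.ofLaurent {K F : Type*} [Field K] [Field F] (Ψ : K →+* LaurentSeries F)
    {π : K} (hπ : (Ψ π).order = 1) : DiscreteValuation K where
  v x := (Ψ (x : K)).order
  map_mul' x y := by
    rw [Units.val_mul, map_mul, HahnSeries.order_mul] <;> simp
  surjective' := by
    have h0 : π ≠ 0 := by
      rintro rfl
      simp at hπ
    have hmul : ∀ x y : Kˣ, (Ψ ((x * y : Kˣ) : K)).order = (Ψ (x : K)).order + (Ψ (y : K)).order := by
      intro x y
      rw [Units.val_mul, map_mul, HahnSeries.order_mul] <;> simp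
    let f : Kˣ →* Multiplicative ℤ :=
      { toFun := fun x => Multiplicative.ofAdd (Ψ (x : K)).order
        map_one' := by simp
        map_mul' := fun x y => by rw [hmul]; rfl }
    intro n
    refine ⟨Units.mk0 π h0 ^ n, ?_⟩
    have h := map_zpow f (Units.mk0 π h0) n
    have h1 : f (Units.mk0 π h0) = Multiplicative.ofAdd 1 := by
      simp [f, hπ]
    rw [h1, ← ofAdd_zsmul] at h
    simpa [f] using congrArg Multiplicative.toAdd h
  min_le' x y z h := by
    rw [← h, map_add]
    apply HahnSeries.min_order_le_order_add
    rw [← map_add, h]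
    simp

lemma exists_root_of_isCoprime_derivative {F : Type*} [Field F] [IsAlgClosed F]
    {m : (PowerSeries F)[X]} (hm : m.Monic) (hdeg : m.natDegree ≠ 0)
    (hs : IsCoprime m (derivative m)) :
    ∃ r : PowerSeries F, m.eval r = 0 := by
  have hmon := hm.map (PowerSeries.constantCoeff (R := F))
  obtain ⟨c, hc⟩ := IsAlgClosed.exists_root (m.map (PowerSeries.constantCoeff (R := F))) (by
    rw [hm.degree_map]
    intro h
    exact hdeg (natDegree_eq_of_degree_eq_some h))
  have heval : ∀ q : (PowerSeries F)[X], PowerSeries.constantCoeff (q.eval (PowerSeries.C c)) =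
      (q.map (PowerSeries.constantCoeff (R := F))).eval c := by
    intro q
    rw [← eval_map_apply, PowerSeries.constantCoeff_C]
  have hd : (derivative m).eval (PowerSeries.C c) |> PowerSeries.constantCoeff |> (· ≠ 0) := by
    obtain ⟨a, b, hab⟩ := hs
    intro h
    have h1 := congrArg (fun q => PowerSeries.constantCoeff (eval (PowerSeries.C c) q)) hab
    simp only [eval_add, eval_mul, map_add, map_mul, h, heval m, hc.eq_zero] at h1
    simp at h1
  have hmem : m.eval (PowerSeries.C c) ∈ Ideal.span {(PowerSeries.X : PowerSeries F)} := by
    rw [Ideal.mem_span_singleton, PowerSeries.X_dvd_iff, heval, hc.eq_zero]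
  obtain ⟨r, hr, -⟩ := HenselianRing.is_henselian
    (I := Ideal.span {(PowerSeries.X : PowerSeries F)}) m hm (PowerSeries.C c) hmem (by
      apply IsUnit.map
      rw [PowerSeries.isUnit_iff_constantCoeff]
      exact isUnit_iff_ne_zero.mpr hd)
  exact ⟨r, hr⟩

lemma exists_extension_laurent {F B K : Type*} [Field F] [IsAlgClosed F] [Field B] [Field K]
    [Algebra B K] (pb : PowerBasis B K) (ψ : B →+* LaurentSeries F) {a b : B[X]}
    (hab : a * minpoly B pb.gen + b * derivative (minpoly B pb.gen) = 1)
    (h : ∀ q ∈ ({minpoly B pb.gen, a, b} : Set B[X]), ∀ n,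
      ψ (q.coeff n) ∈ (HahnSeries.ofPowerSeries ℤ F).range) :
    ∃ Ψ : K →+* LaurentSeries F, ∀ x, Ψ (algebraMap B K x) = ψ x := by
  have hlift : ∀ q ∈ ({minpoly B pb.gen, a, b} : Set B[X]),
      q.map ψ ∈ lifts (HahnSeries.ofPowerSeries ℤ F) := by
    intro q hq
    rw [lifts_iff_coeff_lifts]
    intro n
    rw [coeff_map]
    exact h q hq n
  have hfin : FiniteDimensional B K := pb.finite
  have hint : IsIntegral B pb.gen := pb.isIntegral_gen
  obtain ⟨m', hm', hdeg, hmon⟩ := lifts_and_natDegree_eq_and_monic (hlift _ (by simp))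
    ((minpoly.monic hint).map ψ)
  obtain ⟨a', ha'⟩ := (mem_lifts _).mp (hlift a (by simp))
  obtain ⟨b', hb'⟩ := (mem_lifts _).mp (hlift b (by simp))
  obtain ⟨r, hr⟩ := exists_root_of_isCoprime_derivative hmon (by
    rw [hdeg, natDegree_map]
    exact (minpoly.natDegree_pos hint).ne') ⟨a', b', by
      apply map_injective _ (HahnSeries.ofPowerSeries_injective (Γ := ℤ) (R := F))
      rw [Polynomial.map_add, Polynomial.map_mul, Polynomial.map_mul, ← derivative_map, ha', hb',
        hm', derivative_map, ← Polynomial.map_mul, ← Polynomial.map_mul, ← Polynomial.map_add, hab]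
      simp⟩
  let _ : Algebra B (LaurentSeries F) := ψ.toAlgebra
  refine ⟨(pb.lift (HahnSeries.ofPowerSeries ℤ F r) ?_ : K →ₐ[B] LaurentSeries F).toRingHom, ?_⟩
  · rw [aeval_def, eval₂_eq_eval_map]
    change eval _ ((minpoly B pb.gen).map ψ) = 0
    rw [← hm', eval_map_apply, hr, map_zero]
  · intro x
    exact AlgHom.commutes _ x

/-- The Taylor expansion at `L` of polynomials over `C`, as power series over `F`. -/
def taylorSeries {C : Type*} (F : Type*) [Field C] [Field F] [Algebra C F] (L : C) :
    C[X] →+* PowerSeries F :=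
  ((Polynomial.coeToPowerSeries.ringHom (R := F)).comp
    (mapRingHom (algebraMap C F))).comp (taylorAlgHom L : C[X] →ₐ[C] C[X]).toRingHom

section taylorSeries

variable {C F : Type*} [Field C] [Field F] [Algebra C F] (L : C)

lemma taylorSeries_apply (P : C[X]) :
    taylorSeries F L P = (((taylor L P).map (algebraMap C F) : F[X]) : PowerSeries F) := rfl

lemma taylorSeries_injective : Function.Injective (taylorSeries F L : C[X] →+* PowerSeries F) :=
  fun _ _ h => taylor_injective L (map_injective _ (algebraMap C F).injective
    (Polynomial.coe_injective F h))

lemma constantCoeff_taylorSeries (P : C[X]) :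
    PowerSeries.constantCoeff (taylorSeries F L P) = algebraMap C F (P.eval L) := by
  simp [taylorSeries_apply, taylor_coeff_zero, aeval_algebraMap_apply]

end taylorSeries

lemma exists_expansion {C K : Type*} (F : Type*) [Field C] [Field K] [Field F] [Algebra C K]
    [Algebra C F] {y : K} (hy : Transcendental C y) (L : C) :
    ∃ ψ : C⟮y⟯ →+* LaurentSeries F, ∀ P : C[X],
      ψ (aeval (IntermediateField.AdjoinSimple.gen C y) P) =
        HahnSeries.ofPowerSeries ℤ F (taylorSeries F L P) := by
  have hinj : Function.Injective
      ((HahnSeries.ofPowerSeries ℤ F).comp (taylorSeries F L : C[X] →+* PowerSeries F)) :=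
    HahnSeries.ofPowerSeries_injective.comp (taylorSeries_injective L)
  refine ⟨(IsFractionRing.lift (K := RatFunc C) hinj).comp
    (RatFunc.algEquivOfTranscendental y hy).symm.toRingHom, fun P => ?_⟩
  have h := RatFunc.algEquivOfTranscendental_symm_aeval y hy P
  change IsFractionRing.lift hinj ((RatFunc.algEquivOfTranscendental y hy).symm _) = _
  rw [h, IsFractionRing.lift_algebraMap]
  rfl

lemma exists_common_denominator {C K : Type*} [Field C] [Field K] [Algebra C K] (y : K)
    (hy : Transcendental C y) (T : Finset C⟮y⟯) : ∃ D : C[X], D ≠ 0 ∧ ∀ e ∈ T, ∃ N : C[X],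
      e * aeval (IntermediateField.AdjoinSimple.gen C y) D =
        aeval (IntermediateField.AdjoinSimple.gen C y) N := by
  classical
  set f := RatFunc.algEquivOfTranscendental y hy with hf
  obtain ⟨D, hD⟩ := IsLocalization.exist_integer_multiples_of_finset (nonZeroDivisors C[X])
    (T.image f.symm)
  refine ⟨D, nonZeroDivisors.ne_zero D.2, fun e he => ?_⟩
  obtain ⟨N, hN⟩ := hD (f.symm e) (Finset.mem_image_of_mem _ he)
  refine ⟨N, ?_⟩
  have h := congrArg f hN
  rw [Algebra.smul_def, map_mul, RatFunc.algEquivOfTranscendental_algebraMap,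
    RatFunc.algEquivOfTranscendental_algebraMap, AlgEquiv.apply_symm_apply] at h
  rw [h, mul_comm]

/-- If `K` is finite separable over the rational function field `C(y)`, then for all but finitely
many `L ∈ C` the place `y = L` of `C(y)` has an unramified extension to `K`. -/
lemma finite_setOf_not_unramified {C K : Type*} [Field C] [Field K] [Algebra C K] {y : K}
    (hy : Transcendental C y) [FiniteDimensional C⟮y⟯ K] [Algebra.IsSeparable C⟮y⟯ K] :
    {L : C | ¬ ∃ v : DiscreteValuation K, (∀ c : C, v.val (algebraMap C K c) = 0) ∧
      v.val (y - algebraMap C K L) = 1}.Finite := by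
  classical
  let F := AlgebraicClosure C
  let pb := Field.powerBasisOfFiniteOfSeparable C⟮y⟯ K
  set m := minpoly C⟮y⟯ pb.gen with hm
  obtain ⟨a, b, hab⟩ : IsCoprime m (derivative m) := Algebra.IsSeparable.isSeparable C⟮y⟯ pb.gen
  obtain ⟨D, hD0, hD⟩ := exists_common_denominator y hy (m.coeffs ∪ a.coeffs ∪ b.coeffs)
  refine (D.roots.toFinset.finite_toSet).subset fun L hL => ?_
  by_contra hroot
  apply hL
  replace hroot : D.eval L ≠ 0 := by
    intro h
    exact hroot (by simpa [hD0] using h)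
  obtain ⟨ψ, hψ⟩ := exists_expansion F hy L
  have hunit : IsUnit (taylorSeries F L D) := by
    rw [PowerSeries.isUnit_iff_constantCoeff, constantCoeff_taylorSeries]
    simpa using hroot
  obtain ⟨E, hE⟩ := hunit.exists_right_inv
  have hrange : ∀ q ∈ ({m, a, b} : Set C⟮y⟯[X]), ∀ n,
      ψ (q.coeff n) ∈ (HahnSeries.ofPowerSeries ℤ F).range := by
    intro q hq n
    by_cases h0 : q.coeff n = 0
    · rw [h0, map_zero]
      exact zero_mem _
    have hmem : q.coeff n ∈ m.coeffs ∪ a.coeffs ∪ b.coeffs := by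
      have := coeff_mem_coeffs h0
      rcases hq with rfl | rfl | rfl <;> simp [this]
    obtain ⟨N, hN⟩ := hD _ hmem
    have h1 := congrArg ψ hN
    rw [map_mul, hψ, hψ] at h1
    refine ⟨taylorSeries F L N * E, ?_⟩
    rw [map_mul, ← h1, mul_assoc, ← map_mul, hE, map_one, mul_one]
  obtain ⟨Ψ, hΨ⟩ := exists_extension_laurent pb ψ hab hrange
  have hpoly : ∀ P : C[X], Ψ (aeval y P) = HahnSeries.ofPowerSeries ℤ F (taylorSeries F L P) := by
    intro P
    rw [← hψ, ← hΨ]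
    congr 1
    rw [← aeval_algebraMap_apply, IntermediateField.AdjoinSimple.algebraMap_gen]
  have hπ : (Ψ (y - algebraMap C K L)).order = 1 := by
    have h := hpoly (X - Polynomial.C L)
    rw [map_sub, aeval_X, aeval_C] at h
    rw [h]
    have : taylorSeries F L (X - Polynomial.C L) = PowerSeries.X := by
      simp [taylorSeries_apply]
    rw [this, HahnSeries.ofPowerSeries_X, HahnSeries.order_single one_ne_zero]
  have hval : ∀ x : K, x ≠ 0 → (DiscreteValuation.ofLaurent Ψ hπ).val x = (Ψ x).order := by
    intro x hx
    rw [DiscreteValuation.val_of_ne _ hx]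
    rfl
  refine ⟨DiscreteValuation.ofLaurent Ψ hπ, fun c => ?_, ?_⟩
  · by_cases hc : algebraMap C K c = 0
    · simp [hc, DiscreteValuation.val]
    · rw [hval _ hc]
      have h := hpoly (Polynomial.C c)
      rw [aeval_C] at h
      rw [h, taylorSeries_apply, taylor_C, map_C, Polynomial.coe_C, HahnSeries.ofPowerSeries_C,
        HahnSeries.order_C]
  · rw [hval _ ?_, hπ]
    intro h
    simp [h] at hπ

end places

section bertini

open Polynomial

lemma mem_range_map_of_forall_eval {k G : Type*} [Field k] [Infinite k] [Field G] [Algebra k G]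
    (N : G[X]) (hN : ∀ c : k, ∃ r : k, N.eval (algebraMap k G c) = algebraMap k G r) :
    ∃ P : k[X], P.map (algebraMap k G) = N := by
  classical
  choose r hr using hN
  obtain ⟨s, hs⟩ := Infinite.exists_subset_card_eq k (N.natDegree + 1)
  have hinj : Set.InjOn (id : k → k) s := fun _ _ _ _ h => h
  refine ⟨Lagrange.interpolate s id r, ?_⟩
  have hcard : (s.image (algebraMap k G)).card = s.card :=
    Finset.card_image_of_injective _ (algebraMap k G).injective
  apply eq_of_degrees_lt_of_eval_finset_eq (s.image (algebraMap k G))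
  · rw [hcard]
    exact degree_map_le.trans_lt (Lagrange.degree_interpolate_lt r hinj)
  · rw [hcard, hs]
    exact degree_le_natDegree.trans_lt (by exact_mod_cast Nat.lt_succ_self _)
  · intro x hx
    obtain ⟨c, hc, rfl⟩ := Finset.mem_image.mp hx
    rw [eval_map_apply, hr]
    congr 1
    exact Lagrange.eval_interpolate_at_node r hinj hc

variable {k K : Type*} [Field k] [Field K] [Algebra k K]

open scoped IntermediateField.algebraAdjoinAdjoin in
lemma exists_monic_of_isAlgebraic {u e : K} (hu : Transcendental k u) (he : IsAlgebraic k⟮u⟯ e) :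
    ∃ q : k[X], q ≠ 0 ∧ ∃ Φ : k[X][X], Φ.Monic ∧
      Φ.eval₂ (aeval u : k[X] →ₐ[k] K).toRingHom (aeval u q * e) = 0 := by
  have h1 : IsAlgebraic (Algebra.adjoin k {u}) e :=
    (IsFractionRing.isAlgebraic_iff (Algebra.adjoin k {u}) k⟮u⟯ K).mpr he
  obtain ⟨a, ha0, p, hp, hpe⟩ := h1.exists_integral_multiple
  let f := Polynomial.algEquivOfTranscendental k u hu
  have hf : ∀ q : k[X], (f q : K) = aeval u q := by
    intro q
    simp [f]
  have hfa : ∀ x, aeval u (f.symm x) = algebraMap (Algebra.adjoin k {u}) K x := by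
    intro x
    rw [← hf, AlgEquiv.apply_symm_apply]
    rfl
  have hcomp : (aeval u : k[X] →ₐ[k] K).toRingHom.comp f.symm.toRingEquiv.toRingHom =
      algebraMap (Algebra.adjoin k {u}) K := RingHom.ext hfa
  refine ⟨f.symm a, by simpa using ha0, p.map f.symm.toRingEquiv.toRingHom, hp.map _, ?_⟩
  rw [eval₂_map, hcomp, hfa, ← Algebra.smul_def]
  exact hpe

/-- Adjoining a transcendental element to a constant field extension creates no new algebraic
elements over `k(u)`, for `k` algebraically closed. -/
lemma mem_adjoin_of_isAlgebraic [IsAlgClosed k] (G : IntermediateField k K) {u e : K}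
    (hu : Transcendental G u) (he : e ∈ IntermediateField.adjoin G {u})
    (halg : IsAlgebraic k⟮u⟯ e) : e ∈ k⟮u⟯ := by
  have : Infinite k := IsAlgClosed.instInfinite
  have huk : Transcendental k u := hu.of_tower_top k
  obtain ⟨q, hq, Φ, hΦ, hΦe⟩ := exists_monic_of_isAlgebraic huk halg
  let f := RatFunc.algEquivOfTranscendental u hu
  let ι : k[X] →+* G[X] := mapRingHom (algebraMap k G)
  have hι : ∀ P : k[X], aeval u (ι P) = aeval u P := fun P => by
    simp [ι, aeval_map_algebraMap]
  let F : RatFunc G →+* K := (algebraMap (IntermediateField.adjoin G {u}) K).comp f.toRingEquiv.toRingHom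
  have hF : ∀ P : G[X], F (algebraMap G[X] (RatFunc G) P) = aeval u P := by
    intro P
    change ((f (algebraMap G[X] (RatFunc G) P) : IntermediateField.adjoin G {u}) : K) = _
    rw [RatFunc.algEquivOfTranscendental_algebraMap]
    simp
  let e' : RatFunc G := f.symm ⟨e, he⟩
  have he' : F e' = e := by
    change ((f (f.symm ⟨e, he⟩) : IntermediateField.adjoin G {u}) : K) = _
    rw [AlgEquiv.apply_symm_apply]
  have hint : IsIntegral G[X] (algebraMap G[X] (RatFunc G) (ι q) * e') := by
    refine ⟨Φ.map ι, hΦ.map _, F.injective ?_⟩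
    have hcomp : (F.comp (algebraMap G[X] (RatFunc G))).comp ι =
        (aeval u : k[X] →ₐ[k] K).toRingHom := RingHom.ext fun P => (hF _).trans (hι P)
    rw [map_zero, hom_eval₂, eval₂_map, map_mul, hF, he', hι, hcomp, hΦe]
  obtain ⟨N, hN⟩ := IsIntegrallyClosed.isIntegral_iff.mp hint
  have hNu : aeval u N = aeval u q * e := by
    rw [← hF, hN, map_mul, hF, he', hι]
  have hrel : Φ.eval₂ ι N = 0 := by
    apply transcendental_iff_injective.mp hu
    change (aeval u : G[X] →ₐ[G] K).toRingHom _ = _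
    rw [map_zero, hom_eval₂]
    have hcomp : (aeval u : G[X] →ₐ[G] K).toRingHom.comp ι =
        (aeval u : k[X] →ₐ[k] K).toRingHom := RingHom.ext hι
    change Φ.eval₂ _ (aeval u N) = 0
    rw [hNu, hcomp, hΦe]
  obtain ⟨P, hP⟩ := mem_range_map_of_forall_eval N (fun c : k => by
    by_contra! hc
    have hmem : N.eval (algebraMap k G c) ∉ (⊥ : IntermediateField k G) := by
      rw [IntermediateField.mem_bot]
      rintro ⟨r, hr⟩
      exact hc r hr.symm
    refine transcendental_of_notMem_bot hmem ⟨Φ.map (evalRingHom c), (hΦ.map _).ne_zero, ?_⟩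
    have h := congrArg (evalRingHom (algebraMap k G c)) hrel
    have hcomp : (evalRingHom (algebraMap k G c)).comp ι =
        (algebraMap k G).comp (evalRingHom c) :=
      RingHom.ext fun P => eval_map_apply (algebraMap k G) c
    rw [hom_eval₂, map_zero, hcomp] at h
    rw [aeval_def, eval₂_map]
    exact h)
  have hPu : aeval u P = aeval u q * e := by
    rw [← hNu, ← hP, aeval_map_algebraMap]
  have hq0 : aeval u q ≠ 0 := fun h => hq (transcendental_iff.mp huk q h)
  rw [eq_div_of_mul_eq hq0 ((mul_comm _ _).trans hPu.symm)]
  have hmem : ∀ P : k[X], aeval u P ∈ k⟮u⟯ := fun P =>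
    IntermediateField.algebra_adjoin_le_adjoin k {u} (aeval_mem_adjoin_singleton k u)
  exact div_mem (hmem _) (hmem _)

open scoped IntermediateField.algebraAdjoinAdjoin in
open AlgebraicIndependent in
lemma mem_matroid_closure_iff {s : Set K} {x : K} :
    x ∈ (matroid k K).closure s ↔ IsAlgebraic (IntermediateField.adjoin k s) x := by
  rw [matroid_closure_eq]
  exact IsFractionRing.isAlgebraic_iff (Algebra.adjoin k s) (IntermediateField.adjoin k s) K

variable (k) in
/-- The relative algebraic closure in `K` of the subextension generated by `s`. -/
def relClosure (s : Set K) : IntermediateField k K :=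
  (algebraicClosure (IntermediateField.adjoin k s) K).restrictScalars k

lemma mem_relClosure {s : Set K} {x : K} :
    x ∈ relClosure k s ↔ IsAlgebraic (IntermediateField.adjoin k s) x :=
  mem_algebraicClosure_iff

lemma relAlgClosed_relClosure (s : Set K) : RelAlgClosed (relClosure k s) := by
  intro x hx
  have hx' : IsAlgebraic (algebraicClosure (IntermediateField.adjoin k s) K) x := hx
  rw [mem_relClosure]
  exact hx'.restrictScalars (IntermediateField.adjoin k s)

lemma mem_relClosure_iff_closure {s : Set K} {x : K} :
    x ∈ relClosure k s ↔ x ∈ (AlgebraicIndependent.matroid k K).closure s := by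
  rw [mem_relClosure, mem_matroid_closure_iff]

lemma relClosure_mono {s t : Set K} (h : s ⊆ t) : relClosure k s ≤ relClosure k t := fun _ hx =>
  mem_relClosure_iff_closure.mpr
    ((AlgebraicIndependent.matroid k K).closure_subset_closure h (mem_relClosure_iff_closure.mp hx))

lemma subset_relClosure (s : Set K) : s ⊆ relClosure k s := fun _ hx =>
  mem_relClosure_iff_closure.mpr
    ((AlgebraicIndependent.matroid k K).subset_closure s (Set.subset_univ _) hx)

/-- A Bertini type statement: if `K` is finite separable over `B` and any two members of the
family `g` generate `B` over a field of transcendence degree two less than that of `K`, then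
almost all members of the family are general elements. -/
lemma finite_setOf_not_isGeneralElement [IsAlgClosed k] (B : IntermediateField k K)
    [FiniteDimensional B K] [Algebra.IsSeparable B K] {S ρ : Set K} (hS : AlgebraicIndepOn k id S)
    (hSB : S ⊆ B) (hcard : ρ.encard + 1 < S.encard) (g : k → K)
    (hgB : ∀ c c', c ≠ c' → B ≤ IntermediateField.adjoin k (insert (g c) (insert (g c') ρ))) :
    {c | ¬ IsGeneralElement k (g c)}.Finite := by
  have : Infinite k := IsAlgClosed.instInfinite
  set M := AlgebraicIndependent.matroid k K with hM
  have hnot : ∀ c c', c ≠ c' → g c ∉ relClosure k (insert (g c') ρ) := by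
    intro c c' hc hmem
    have h1 : S ⊆ M.closure (insert (g c') ρ) := by
      intro s hs
      rw [← mem_relClosure_iff_closure]
      refine IntermediateField.adjoin_le_iff.mpr ?_ (hgB c c' hc (hSB hs))
      exact Set.insert_subset hmem (subset_relClosure _)
    have h2 : M.Indep S := AlgebraicIndependent.matroid_indep_iff.mpr hS
    have h3 := h2.encard_le_eRk_of_subset h1
    rw [Matroid.eRk_closure_eq] at h3
    exact absurd ((h3.trans (M.eRk_le_encard _)).trans (Set.encard_insert_le _ _)) hcard.not_ge
  have hbot : ∀ c, g c ∉ (⊥ : IntermediateField k K) := by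
    intro c h
    obtain ⟨c', hc'⟩ := exists_ne c
    exact hnot c c' hc'.symm (bot_le (a := relClosure k (insert (g c') ρ)) h)
  have hfin : Finite (IntermediateField B K) :=
    Field.finite_intermediateField_of_exists_primitive_element B K
      (Field.exists_primitive_element B K)
  have hex : ∀ c : {c | ¬ IsGeneralElement k (g c)}, ∃ e : K, IsAlgebraic k⟮g c⟯ e ∧ e ∉ k⟮g c⟯ := by
    rintro ⟨c, hc⟩
    by_contra! h
    exact hc ⟨hbot c, h⟩
  choose e he he' using hex
  rw [← Set.finite_coe_iff]
  refine Finite.of_injective (fun c => IntermediateField.adjoin B {e c}) fun c c' hcc => ?_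
  by_contra hne
  have hne' : (c : k) ≠ c' := fun h => hne (Subtype.ext h)
  let G := relClosure k (insert (g c') ρ)
  have htrans : Transcendental G (g c) := fun h => hnot c c' hne' (relAlgClosed_relClosure _ _ h)
  apply he' c
  apply mem_adjoin_of_isAlgebraic G htrans _ (he c)
  have h1 : e c ∈ IntermediateField.adjoin B {e c'} :=
    (show IntermediateField.adjoin B {e c} = IntermediateField.adjoin B {e c'} from hcc) ▸
      IntermediateField.mem_adjoin_simple_self B (e c)
  have h2 : e c' ∈ G := by
    apply relClosure_mono (Set.singleton_subset_iff.mpr (Set.mem_insert (g c') ρ))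
    exact mem_relClosure.mpr (he c')
  let H : IntermediateField k K := (IntermediateField.adjoin G {g c}).restrictScalars k
  have hGH : G ≤ H := fun x hx => (IntermediateField.adjoin G {g c}).algebraMap_mem ⟨x, hx⟩
  have h3 : B ≤ H := by
    refine (hgB c c' hne').trans (IntermediateField.adjoin_le_iff.mpr ?_)
    exact Set.insert_subset (IntermediateField.mem_adjoin_simple_self G (g c))
      ((subset_relClosure _).trans hGH)
  have h4 : (IntermediateField.adjoin B {e c'}).restrictScalars k ≤ H := by
    rw [IntermediateField.restrictScalars_adjoin_eq_sup]
    exact sup_le h3 (IntermediateField.adjoin_le_iff.mpr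
      (Set.singleton_subset_iff.mpr (hGH h2)))
  exact h4 h1

end bertini

section separating

open Polynomial

lemma exists_sum_X_pow_mul_pow {k : Type*} [Field k] (p : ℕ) [Fact p.Prime] [CharP k p]
    [PerfectRing k p] (f : k[X]) :
    ∃ c : ℕ → k[X], f = ∑ j ∈ Finset.range p, X ^ j * c j ^ p := by
  have hp : p.Prime := Fact.out
  induction f using Polynomial.induction_on' with
  | add f g hf hg =>
    obtain ⟨a, rfl⟩ := hf
    obtain ⟨b, rfl⟩ := hg
    refine ⟨a + b, ?_⟩
    rw [← Finset.sum_add_distrib]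
    exact Finset.sum_congr rfl fun j _ => by rw [Pi.add_apply, add_pow_char, mul_add]
  | monomial n a =>
    obtain ⟨b, rfl⟩ := surjective_frobenius k p a
    refine ⟨fun j => if j = n % p then monomial (n / p) b else 0, ?_⟩
    rw [Finset.sum_eq_single (n % p)]
    · dsimp only
      rw [if_pos rfl, monomial_pow, ← monomial_one_right_eq_X_pow, monomial_mul_monomial, one_mul,
        mul_comm (n / p), Nat.mod_add_div, frobenius_def]
    · intro j _ hj
      dsimp only
      rw [if_neg hj, zero_pow hp.ne_zero, mul_zero]
    · intro h
      exact absurd (Finset.mem_range.mpr (Nat.mod_lt _ hp.pos)) h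

variable {k K : Type*} [Field k] [Field K] [Algebra k K]

lemma exists_eq_sum_pow_mul_pow (p : ℕ) [Fact p.Prime] [CharP k p] [PerfectRing k p] (x : K)
    (e : k⟮x⟯) : ∃ c : ℕ → k⟮x⟯, (e : K) = ∑ j ∈ Finset.range p, x ^ j * (c j : K) ^ p := by
  have hp : p.Prime := Fact.out
  obtain ⟨f, g, hfg⟩ := IntermediateField.mem_adjoin_simple_iff k (e : K) |>.mp e.2
  have hmem : ∀ P : k[X], aeval x P ∈ k⟮x⟯ := fun P =>
    IntermediateField.algebra_adjoin_le_adjoin _ _ (aeval_mem_adjoin_singleton _ _)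
  obtain ⟨c, hc⟩ := exists_sum_X_pow_mul_pow p (f * g ^ (p - 1))
  refine ⟨fun j => ⟨aeval x (c j) / aeval x g, div_mem (hmem _) (hmem _)⟩, ?_⟩
  by_cases hg : aeval x g = 0
  · simp [hfg, hg, zero_pow hp.ne_zero]
  have h : aeval x f * aeval x g ^ (p - 1) =
      ∑ j ∈ Finset.range p, x ^ j * aeval x (c j) ^ p := by
    simpa using congrArg (aeval x) hc
  simp only [div_pow, ← mul_div_assoc]
  rw [← Finset.sum_div, ← h, hfg, div_eq_div_iff hg (pow_ne_zero _ hg), mul_assoc, ← pow_succ,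
    Nat.sub_add_cancel hp.one_le]

lemma eq_zero_of_sum_pow_mul_pow_eq_zero (p : ℕ) [Fact p.Prime] [CharP K p] {x : K}
    (hx : ∀ y : K, y ^ p ≠ x) {b : ℕ → K} (h : ∑ j ∈ Finset.range p, x ^ j * b j ^ p = 0)
    {j : ℕ} (hj : j < p) : b j = 0 := by
  have hp : p.Prime := Fact.out
  let E := (frobenius K p).fieldRange
  have hmem : ∀ y : K, y ^ p ∈ E := fun y => ⟨y, rfl⟩
  let q : E[X] := ∑ i ∈ Finset.range p, monomial i ⟨b i ^ p, hmem _⟩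
  have hq : aeval x q = 0 := by
    rw [map_sum, ← h]
    refine Finset.sum_congr rfl fun i _ => ?_
    rw [aeval_monomial, mul_comm]
    rfl
  have hirr : Irreducible (X ^ p - C (⟨x ^ p, hmem x⟩ : E)) := by
    refine X_pow_sub_C_irreducible_of_prime hp fun e he => ?_
    obtain ⟨_, y, rfl⟩ := e
    have h1 : (frobenius K p y) ^ p = x ^ p := congrArg Subtype.val he
    exact hx y (frobenius_inj K p h1)
  have hmin : X ^ p - C (⟨x ^ p, hmem x⟩ : E) = minpoly E x := by
    refine minpoly.eq_of_irreducible_of_monic hirr ?_ (monic_X_pow_sub_C _ hp.ne_zero)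
    rw [map_sub, map_pow, aeval_X, aeval_C, sub_eq_zero]
    rfl
  have hdeg : q.degree < (minpoly E x).degree := by
    rw [← hmin, degree_X_pow_sub_C hp.pos]
    refine (degree_sum_le _ _).trans_lt ((Finset.sup_lt_iff (WithBot.bot_lt_coe p)).mpr ?_)
    intro i hi
    exact (degree_monomial_le _ _).trans_lt (Nat.cast_lt.mpr (Finset.mem_range.mp hi))
  have hq0 : q = 0 := by
    by_contra hne
    exact (minpoly.degree_le_of_ne_zero E x hne hq).not_gt hdeg
  have hcoeff : q.coeff j = ⟨b j ^ p, hmem _⟩ := by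
    simp only [q, finsetSum_coeff, coeff_monomial]
    rw [Finset.sum_ite_eq' , if_pos (Finset.mem_range.mpr hj)]
  rw [hq0, coeff_zero] at hcoeff
  exact pow_eq_zero_iff hp.ne_zero |>.mp (congrArg Subtype.val hcoeff).symm

lemma linearIndepOn_pow_of_forall_pow_ne (p : ℕ) [Fact p.Prime] [CharP k p] [PerfectRing k p]
    {x : K} (hx : ∀ y : K, y ^ p ≠ x) (s : Finset K)
    (hs : LinearIndepOn k⟮x⟯ _root_.id (s : Set K)) :
    LinearIndepOn k⟮x⟯ (· ^ p) (s : Set K) := by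
  have : CharP K p := charP_of_injective_algebraMap (algebraMap k K).injective p
  rw [linearIndepOn_finset_iff] at hs ⊢
  intro g hg i hi
  choose c hc using exists_eq_sum_pow_mul_pow (k := k) p x
  have hzero : ∀ j < p, ∑ i ∈ s, c (g i) j • i = 0 := by
    intro j hj
    refine eq_zero_of_sum_pow_mul_pow_eq_zero p hx (b := fun j => ∑ i ∈ s, c (g i) j • i) ?_ hj
    rw [← hg]
    simp_rw [sum_pow_char, Finset.mul_sum]
    rw [Finset.sum_comm]
    refine Finset.sum_congr rfl fun i _ => ?_
    rw [IntermediateField.smul_def, smul_eq_mul, hc, Finset.sum_mul]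
    refine Finset.sum_congr rfl fun j _ => ?_
    rw [IntermediateField.smul_def, smul_eq_mul, mul_pow, mul_assoc]
  have hci : ∀ j < p, c (g i) j = 0 := fun j hj => hs (fun i => c (g i) j) (hzero j hj) i hi
  apply Subtype.ext
  rw [hc]
  refine Finset.sum_eq_zero fun j hj => ?_
  rw [hci j (Finset.mem_range.mp hj)]
  simp [(Fact.out : p.Prime).ne_zero]

/-- A nonconstant separable element of a function field over a perfect field belongs to a
separating transcendence basis. -/
lemma exists_separating_basis_mem [PerfectField k] [Algebra.EssFiniteType k K] {x : K}
    (htr : Transcendental k x) (hx : IsSeparableIn K x) :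
    ∃ S : Set K, x ∈ S ∧ AlgebraicIndepOn k id S ∧
      Algebra.IsSeparable (IntermediateField.adjoin k S) K := by
  have hess : Algebra.EssFiniteType k⟮x⟯ K := Algebra.EssFiniteType.of_comp k k⟮x⟯ K
  obtain ⟨s, hs, hsep⟩ : ∃ s : Finset K, IsTranscendenceBasis k⟮x⟯ ((↑) : s → K) ∧
      Algebra.IsSeparable (IntermediateField.adjoin k⟮x⟯ (s : Set K)) K := by
    obtain _ | ⟨p, hp, hpk⟩ := CharP.exists' k
    · have : CharZero k⟮x⟯ := charZero_of_injective_algebraMap (algebraMap k k⟮x⟯).injective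
      exact exists_isTranscendenceBasis_and_isSeparable_of_perfectField _ K
    · have hKp : CharP K p := charP_of_injective_algebraMap (algebraMap k K).injective p
      have : CharP k⟮x⟯ p := charP_of_injective_algebraMap (algebraMap k k⟮x⟯).injective p
      have : ExpChar k p := .prime hp.out
      have : ExpChar k⟮x⟯ p := .prime hp.out
      exact exists_isTranscendenceBasis_and_isSeparable_of_linearIndepOn_pow_of_essFiniteType
        p hp.out (linearIndepOn_pow_of_forall_pow_ne p fun y hy => hx p hp.out hKp ⟨y, hy⟩)
  refine ⟨insert x s, Set.mem_insert _ _, ?_, ?_⟩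
  · have h1 : AlgebraicIndependent k
        (fun _ : Unit => IntermediateField.AdjoinSimple.gen k x) := by
      rw [algebraicIndependent_unique_type_iff]
      intro h
      exact htr (by simpa using h.algebraMap (A := K))
    have h2 := (h1.sumElim_comp hs.1).to_subtype_range
    have h3 : Set.range (Sum.elim ((↑) : s → K) (algebraMap k⟮x⟯ K ∘
        fun _ : Unit => IntermediateField.AdjoinSimple.gen k x)) =
        insert x (s : Set K) := by
      rw [Set.Sum.elim_range]
      ext y
      simp [eq_comm, or_comm]
    rw [← h3]
    exact h2
  · have h : (IntermediateField.adjoin k⟮x⟯ (s : Set K)).restrictScalars k =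
        IntermediateField.adjoin k (insert x s) := by
      rw [IntermediateField.adjoin_adjoin_left, Set.singleton_union]
    rw [← h]
    exact hsep

end separating

section product

variable {k K : Type*} [Field k] [Field K] [Algebra k K]

lemma HasTrdeg.nonempty_equiv {d : ℕ} (hd : HasTrdeg k K d) {S : Set K}
    (hS : AlgebraicIndepOn k id S) [Algebra.IsAlgebraic (IntermediateField.adjoin k S) K] :
    Nonempty (Fin d ≃ S) := by
  obtain ⟨b, hb⟩ := hd
  have hS' : IsTranscendenceBasis k ((↑) : S → K) := by
    refine AlgebraicIndependent.isTranscendenceBasis_iff_isAlgebraic hS |>.mpr ?_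
    rw [show Set.range (fun i : S => id (i : K)) = S from Subtype.range_val]
    exact IntermediateField.isAlgebraic_adjoin_iff_top.mp inferInstance
  exact Cardinal.lift_mk_eq'.mp (hb.lift_cardinalMk_eq hS')

lemma AlgebraicIndepOn.transcendental_adjoin_sdiff {S : Set K} (hS : AlgebraicIndepOn k id S) {y : K}
    (hy : y ∈ S) : Transcendental (IntermediateField.adjoin k (S \ {y})) y := by
  have h := hS.transcendental_adjoin (s := {i : S | (i : K) ≠ y}) (i := ⟨y, hy⟩) (by simp)
  have himg : (fun i : S => id (i : K)) '' {i : S | (i : K) ≠ y} = S \ {y} := by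
    ext a
    simp [and_comm]
  rw [himg] at h
  exact fun h' => h (IntermediateField.isAlgebraic_adjoin_iff.mp h')

/-- Almost all specializations of one member of a separating transcendence basis give a divisorial
valuation. -/
lemma finite_setOf_not_isDivisorialType {d : ℕ} (hd : HasTrdeg k K d) {S : Set K}
    (hS : AlgebraicIndepOn k id S) [Algebra.IsSeparable (IntermediateField.adjoin k S) K]
    [FiniteDimensional (IntermediateField.adjoin k S) K] {y : K} (hy : y ∈ S) :
    {L : IntermediateField.adjoin k (S \ {y}) | ¬ ∃ v : DiscreteValuation K,
      IsDivisorialType k d v ∧ (∀ a ∈ IntermediateField.adjoin k (S \ {y}), v.val a = 0) ∧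
      v.val (y - L) = 1}.Finite := by
  set C := IntermediateField.adjoin k (S \ {y}) with hC
  have hadj : C⟮y⟯.restrictScalars k = IntermediateField.adjoin k S := by
    rw [hC, IntermediateField.adjoin_adjoin_left, Set.sdiff_union_self,
      Set.union_eq_left.mpr (Set.singleton_subset_iff.mpr hy)]
  have hfin : FiniteDimensional (C⟮y⟯.restrictScalars k) K := by rw [hadj]; infer_instance
  have hsep : Algebra.IsSeparable (C⟮y⟯.restrictScalars k) K := by rw [hadj]; infer_instance
  have hfin' : FiniteDimensional C⟮y⟯ K := hfin
  have hsep' : Algebra.IsSeparable C⟮y⟯ K := hsep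
  have htr : Transcendental C y := hS.transcendental_adjoin_sdiff hy
  obtain ⟨e⟩ := hd.nonempty_equiv hS
  have : Finite S := Finite.of_equiv _ e
  have hcard : Nat.card ↥(S \ {y}) = d - 1 := by
    have h : S.ncard = d := (Nat.card_congr e.symm).trans (Nat.card_fin d)
    rw [Nat.card_coe_set_eq, Set.ncard_sdiff_singleton_of_mem hy, h]
  have : Finite ↥(S \ {y}) := Finite.Set.subset S Set.sdiff_subset
  let e' := (Finite.equivFinOfCardEq hcard).symm
  refine (finite_setOf_not_unramified htr).subset fun L hL hv => hL ?_
  obtain ⟨v, hv, hvL⟩ := hv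
  have hvC : ∀ a ∈ C, v.val a = 0 := fun a ha => hv ⟨a, ha⟩
  refine ⟨v, isDivisorialType_of_trivial hd v C hvC (fun i => (e' i : K))
    (fun i => IntermediateField.subset_adjoin _ _ (e' i).2) ?_, hvC, hvL⟩
  exact AlgebraicIndependent.comp (hS.mono Set.sdiff_subset) e' e'.injective

/-- If `P` has simple zeros along all `P - e` with `e ∈ k(x)`, then `x` factors through the two
elements `P⁻¹ - (x + 1)` and `x / (P⁻¹ - (x + 1))`, all of whose places lift to `K`. -/
lemma isVeryGeneral_factors [IsAlgClosed k] {ℓ d : ℕ} (hℓ : ℓ.Prime) {x P : K}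
    (hx : x ∉ (⊥ : IntermediateField k K))
    (hP : ∀ e ∈ k⟮x⟯, ∃ v : DiscreteValuation K, IsDivisorialType k d v ∧
      (∀ a ∈ k⟮x⟯, v.val a = 0) ∧ v.val (P - e) = 1)
    (hu : IsGeneralElement k (P⁻¹ - (x + 1)))
    (hw : IsGeneralElement k (x / (P⁻¹ - (x + 1)))) :
    IsVeryGeneral ℓ k d (P⁻¹ - (x + 1)) ∧ IsVeryGeneral ℓ k d (x / (P⁻¹ - (x + 1))) := by
  have hxx : x ∈ k⟮x⟯ := IntermediateField.mem_adjoin_simple_self k x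
  have hk : ∀ b : k, algebraMap k K b ∈ k⟮x⟯ := fun b => IntermediateField.algebraMap_mem _ b
  set z := x + 1 with hz
  have hzx : z ∈ k⟮x⟯ := add_mem hxx (one_mem _)
  have hx0 : x ≠ 0 := fun h => hx (h ▸ zero_mem _)
  have hzb : ∀ b : k, z + algebraMap k K b ≠ 0 := fun b h => hx ⟨-1 - b, by
    change algebraMap k K (-1 - b) = x
    rw [map_sub, map_neg, map_one]
    linear_combination -h⟩
  have hxz : ∀ b : k, x + algebraMap k K b * z ≠ 0 := by
    intro b h
    have h1 : (1 + algebraMap k K b) * x = - algebraMap k K b := by linear_combination h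
    by_cases hb : 1 + b = 0
    · have hb' : 1 + algebraMap k K b = 0 := by rw [← map_one (algebraMap k K), ← map_add, hb, map_zero]
      rw [hb', zero_mul] at h1
      exact one_ne_zero (α := K) (by linear_combination hb' - h1)
    · refine hx ⟨-b / (1 + b), ?_⟩
      have hb' : 1 + algebraMap k K b ≠ 0 := by
        rw [← map_one (algebraMap k K), ← map_add]
        exact (map_ne_zero _).mpr hb
      change algebraMap k K (-b / (1 + b)) = x
      rw [map_div₀, map_neg, map_add, map_one, div_eq_iff hb']
      linear_combination -h1
  have hz0 : z ≠ 0 := by simpa using hzb 0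
  have hne : ∀ (v : DiscreteValuation K) (a : K), v.val a = 1 → a ≠ 0 := by
    rintro v a h rfl
    simp [DiscreteValuation.val] at h
  have hP0 : P ≠ 0 := by
    obtain ⟨v, -, -, h1⟩ := hP 0 (zero_mem _)
    exact hne v _ (by rwa [sub_zero] at h1)
  have hPz : P⁻¹ - z = (1 - z * P) / P := by field_simp
  have hval : ∀ (v : DiscreteValuation K) (e : K), (∀ a ∈ k⟮x⟯, v.val a = 0) → e ∈ k⟮x⟯ → e ≠ 0 →
      v.val (P - e) = 1 → v.val P = 0 := by
    intro v e hv he he0 h1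
    have := v.val_add_of_lt he0 (hne v _ h1) (by rw [hv e he, h1]; exact one_pos)
    rw [add_sub_cancel, hv e he] at this
    exact this.2
  refine ⟨isVeryGeneral_of_places hℓ hu (fun b => ?_) ?_,
    isVeryGeneral_of_places hℓ hw (fun b => ?_) ?_⟩
  · have he : (z + algebraMap k K b)⁻¹ ∈ k⟮x⟯ := inv_mem (add_mem hzx (hk b))
    obtain ⟨v, hvd, hv, h1⟩ := hP _ he
    have hvP := hval v _ hv he (inv_ne_zero (hzb b)) h1
    refine ⟨v, hvd, ?_⟩
    have heq : P⁻¹ - z - algebraMap k K b =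
        -((z + algebraMap k K b) * (P - (z + algebraMap k K b)⁻¹) / P) := by
      have := hzb b
      field_simp
      ring
    rw [heq, v.val_neg, v.val_div (mul_ne_zero (hzb b) (hne v _ h1)) hP0,
      v.val_mul (hzb b) (hne v _ h1), h1, hvP, hv _ (add_mem hzx (hk b))]
    rfl
  · obtain ⟨v, hvd, hv, h1⟩ := hP 0 (zero_mem _)
    rw [sub_zero] at h1
    refine ⟨v, hvd, ?_⟩
    have hvP : v.val P⁻¹ = -1 := by rw [v.val_inv hP0, h1]
    have h2 := v.val_add_of_lt (inv_ne_zero hP0) (neg_ne_zero.mpr hz0)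
      (by rw [hvP, v.val_neg, hv z hzx]; norm_num)
    rw [sub_eq_add_neg, h2.2, hvP]
  · set c := x + algebraMap k K b * z with hc
    have hcx : c ∈ k⟮x⟯ := add_mem hxx (mul_mem (hk b) hzx)
    obtain ⟨v, hvd, hv, h1⟩ := hP _ (div_mem (hk b) hcx)
    have hc0 : c ≠ 0 := hxz b
    have hs := hne v _ h1
    have h2 := v.val_add_of_lt (x := x / c) (y := -(z * (P - algebraMap k K b / c)))
      (div_ne_zero hx0 hc0) (neg_ne_zero.mpr (mul_ne_zero hz0 hs))
      (by rw [v.val_neg, v.val_mul hz0 hs, h1, hv z hzx, hv _ (div_mem hxx hcx)]; norm_num)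
    have h3 : x / c + -(z * (P - algebraMap k K b / c)) = 1 - z * P := by
      field_simp
      rw [hc]
      ring
    rw [h3, hv _ (div_mem hxx hcx)] at h2
    refine ⟨v, hvd, ?_⟩
    have heq : x / (P⁻¹ - z) - algebraMap k K b =
        c * (P - algebraMap k K b / c) / (1 - z * P) := by
      rw [hPz, div_div_eq_mul_div, div_sub' h2.1]
      congr 1
      field_simp
      rw [hc]
      ring
    rw [heq, v.val_div (mul_ne_zero hc0 hs) h2.1, v.val_mul hc0 hs, h1, h2.2, hv c hcx]
    rfl
  · obtain ⟨v, hvd, hv, h1⟩ := hP _ (inv_mem hzx)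
    have hs := hne v _ h1
    have hvP := hval v _ hv (inv_mem hzx) (inv_ne_zero hz0) h1
    refine ⟨v, hvd, ?_⟩
    have heq : x / (P⁻¹ - z) = -(x * P / (z * (P - z⁻¹))) := by
      rw [hPz, div_div_eq_mul_div, ← div_neg]
      congr 1
      field_simp
      ring
    rw [heq, v.val_neg, v.val_div (mul_ne_zero hx0 hP0) (mul_ne_zero hz0 hs),
      v.val_mul hx0 hP0, v.val_mul hz0 hs, h1, hvP, hv x hxx, hv z hzx]
    rfl

end product

section main

variable {k K : Type*} [Field k] [Field K] [Algebra k K]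

lemma finiteDimensional_of_isSeparable_adjoin [Algebra.EssFiniteType k K] (S : Set K)
    [Algebra.IsSeparable (IntermediateField.adjoin k S) K] :
    FiniteDimensional (IntermediateField.adjoin k S) K := by
  have : Algebra.EssFiniteType (IntermediateField.adjoin k S) K := .of_comp k _ K
  have : Algebra.FormallyUnramified (IntermediateField.adjoin k S) K := .of_isSeparable _ K
  exact Algebra.FormallyUnramified.finite_of_free _ K

lemma mem_of_sub_smul_mem (D : IntermediateField k K) {c c' : k} (hc : c ≠ c') {y t : K}
    (h : y - algebraMap k K c * t ∈ D) (h' : y - algebraMap k K c' * t ∈ D) : y ∈ D ∧ t ∈ D := by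
  have ht : t ∈ D := by
    have hne : algebraMap k K c' - algebraMap k K c ≠ 0 :=
      sub_ne_zero.mpr fun h => hc ((algebraMap k K).injective h.symm)
    have heq : t = (y - algebraMap k K c * t - (y - algebraMap k K c' * t)) /
        (algebraMap k K c' - algebraMap k K c) := by
      field_simp
      ring
    rw [heq]
    exact div_mem (sub_mem h h') (sub_mem (D.algebraMap_mem _) (D.algebraMap_mem _))
  refine ⟨?_, ht⟩
  rw [← sub_add_cancel y (algebraMap k K c * t)]
  exact add_mem h (mul_mem (D.algebraMap_mem _) ht)

theorem exists_isVeryGeneral_mul_eq [IsAlgClosed k] [Algebra.EssFiniteType k K] {ℓ d : ℕ}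
    (hℓ : ℓ.Prime) (hd : HasTrdeg k K d) (h3 : 3 ≤ d) {x : K}
    (hx : x ∉ (⊥ : IntermediateField k K)) (hsep : IsSeparableIn K x) :
    ∃ u w : K, IsVeryGeneral ℓ k d u ∧ IsVeryGeneral ℓ k d w ∧ x = u * w := by
  have : Infinite k := IsAlgClosed.instInfinite
  obtain ⟨S, hxS, hS, hSsep⟩ := exists_separating_basis_mem (transcendental_of_notMem_bot hx) hsep
  have : FiniteDimensional (IntermediateField.adjoin k S) K :=
    finiteDimensional_of_isSeparable_adjoin S
  obtain ⟨e⟩ := hd.nonempty_equiv hS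
  have hSfin : Finite S := Finite.of_equiv _ e
  have hcard : S.ncard = d := (Nat.card_congr e.symm).trans (Nat.card_fin d)
  obtain ⟨y, hyS, hyx⟩ : ∃ y ∈ S, y ≠ x :=
    Set.exists_ne_of_one_lt_ncard (by omega) x
  obtain ⟨t, htS, ht⟩ : ∃ t ∈ S, t ∉ ({x, y} : Set K) :=
    Set.exists_mem_notMem_of_ncard_lt_ncard ((Set.ncard_pair hyx.symm).trans_lt (by omega))
      (Set.toFinite _)
  have htx : t ≠ x := fun h => ht (by simp [h])
  have hty : t ≠ y := fun h => ht (by simp [h])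
  have hx0 : x ≠ 0 := fun h => hx (h ▸ zero_mem _)
  set T := S \ {y} with hT
  set ρ := T \ {t} with hρ
  have htT : t ∈ T := ⟨htS, hty⟩
  have hxρ : x ∈ ρ := ⟨⟨hxS, hyx.symm⟩, htx.symm⟩
  have hρcard : ρ.encard + 1 < S.encard := by
    have h1 : T.encard + 1 = S.encard := Set.encard_sdiff_singleton_add_one hyS
    have h2 : ρ.encard + 1 = T.encard := Set.encard_sdiff_singleton_add_one htT
    rw [h2, ← h1]
    exact ENat.lt_add_one_iff (Set.toFinite T).encard_lt_top.ne |>.mpr le_rfl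
  have htρ : Transcendental (IntermediateField.adjoin k ρ) t :=
    (hS.mono Set.sdiff_subset).transcendental_adjoin_sdiff htT
  have hρT : IntermediateField.adjoin k ρ ≤ IntermediateField.adjoin k T :=
    IntermediateField.adjoin.mono _ _ _ Set.sdiff_subset
  let P : k → K := fun c => y - algebraMap k K c * t
  have hplaces : {c : k | ¬ ∀ e ∈ IntermediateField.adjoin k ρ, ∃ v : DiscreteValuation K,
      IsDivisorialType k d v ∧ (∀ a ∈ IntermediateField.adjoin k T, v.val a = 0) ∧
      v.val (P c - e) = 1}.Finite := by
    refine ((finite_setOf_not_isDivisorialType hd hS hyS).biUnion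
      (t := fun L => {c : k | (L : K) - algebraMap k K c * t ∈ IntermediateField.adjoin k ρ})
      fun L _ => Set.Subsingleton.finite ?_).subset ?_
    · intro c hc c' hc'
      by_contra hne
      exact htρ (isAlgebraic_algebraMap
        (⟨t, (mem_of_sub_smul_mem _ hne hc hc').2⟩ : IntermediateField.adjoin k ρ))
    · intro c hc
      simp only [Set.mem_ofPred_eq, not_forall] at hc
      obtain ⟨e, he, hv⟩ := hc
      have htm : algebraMap k K c * t ∈ IntermediateField.adjoin k T :=
        mul_mem (IntermediateField.algebraMap_mem _ c) (IntermediateField.subset_adjoin _ _ htT)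
      refine Set.mem_biUnion (x := ⟨algebraMap k K c * t + e, add_mem htm (hρT he)⟩) ?_ ?_
      · rintro ⟨v, hvd, hv0, hv1⟩
        exact hv ⟨v, hvd, hv0, by rwa [← sub_sub] at hv1⟩
      · simpa using he
  let u : k → K := fun c => (P c)⁻¹ - (x + 1)
  have hgen : ∀ c c', c ≠ c' → ∀ D : IntermediateField k K, ρ ⊆ D → u c ∈ D → u c' ∈ D →
      IntermediateField.adjoin k S ≤ D := by
    intro c c' hc D hρD hu hu'
    have hxD : x + 1 ∈ D := add_mem (hρD hxρ) (one_mem _)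
    have hP : ∀ c, u c ∈ D → P c ∈ D := fun c h => by
      have := inv_mem (add_mem h hxD)
      rwa [sub_add_cancel, inv_inv] at this
    obtain ⟨hy, ht⟩ := mem_of_sub_smul_mem D hc (hP c hu) (hP c' hu')
    refine IntermediateField.adjoin_le_iff.mpr fun s hs => ?_
    by_cases hsy : s = y
    · rwa [hsy]
    by_cases hst : s = t
    · rwa [hst]
    exact hρD ⟨⟨hs, hsy⟩, hst⟩
  have hSB : S ⊆ IntermediateField.adjoin k S := IntermediateField.subset_adjoin k S
  have hins : ∀ a b : K, {a, b} ∪ ρ ⊆ IntermediateField.adjoin k (insert a (insert b ρ)) :=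
    fun a b => by
      rw [Set.insert_union, Set.singleton_union]
      exact IntermediateField.subset_adjoin _ _
  have hugen : {c | ¬ IsGeneralElement k (u c)}.Finite :=
    finite_setOf_not_isGeneralElement (IntermediateField.adjoin k S) hS hSB hρcard u
      fun c c' hc => hgen c c' hc _ (fun a ha => hins _ _ (by simp [ha]))
        (hins _ _ (by simp)) (hins _ _ (by simp))
  have hwgen : {c | ¬ IsGeneralElement k (x / u c)}.Finite := by
    refine finite_setOf_not_isGeneralElement (IntermediateField.adjoin k S) hS hSB hρcard
      (fun c => x / u c) fun c c' hc => ?_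
    have hxD := hins (x / u c) (x / u c') (.inr hxρ)
    have hdiv : ∀ (D : IntermediateField k K) (a : K), x ∈ D → x / a ∈ D → a ∈ D := by
      intro D a hxD ha
      have h := div_mem hxD ha
      rwa [div_div_cancel₀ hx0] at h
    exact hgen c c' hc _ (fun a ha => hins _ _ (by simp [ha]))
      (hdiv _ _ hxD (hins _ _ (by simp))) (hdiv _ _ hxD (hins _ _ (by simp)))
  obtain ⟨c, hc⟩ := ((hplaces.union hugen).union hwgen).exists_notMem
  simp only [Set.mem_union, Set.mem_ofPred_eq, not_or, not_not] at hc
  obtain ⟨⟨hc1, hc2⟩, hc3⟩ := hc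
  have hxle : k⟮x⟯ ≤ IntermediateField.adjoin k ρ :=
    IntermediateField.adjoin.mono _ _ _ (Set.singleton_subset_iff.mpr hxρ)
  have hvg := isVeryGeneral_factors (d := d) hℓ hx (fun e he => by
    obtain ⟨v, hvd, hv0, hv1⟩ := hc1 e (hxle he)
    exact ⟨v, hvd, fun a ha => hv0 a (hρT (hxle ha)), hv1⟩) hc2 hc3
  refine ⟨u c, x / u c, hvg.1, hvg.2, (mul_div_cancel₀ x fun h => hc2.1 ?_).symm⟩
  rw [h]
  exact zero_mem _

lemma exists_isSeparableIn [IsAlgClosed k] [Algebra.EssFiniteType k K] {d : ℕ}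
    (hd : HasTrdeg k K d) (h1 : 1 ≤ d) :
    ∃ z : K, z ∉ (⊥ : IntermediateField k K) ∧ IsSeparableIn K z := by
  have : Infinite k := IsAlgClosed.instInfinite
  obtain ⟨S, hS, hsep⟩ := exists_isTranscendenceBasis_and_isSeparable_of_perfectField k K
  have : FiniteDimensional (IntermediateField.adjoin k (S : Set K)) K :=
    finiteDimensional_of_isSeparable_adjoin _
  have hS' : AlgebraicIndepOn k id (S : Set K) := hS.1
  obtain ⟨e⟩ := hd.nonempty_equiv hS'
  set y : K := (e ⟨0, h1⟩ : (S : Set K)).1 with hy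
  obtain ⟨L, hL⟩ : ∃ L : IntermediateField.adjoin k ((S : Set K) \ {y}), ∃ v : DiscreteValuation K,
      IsDivisorialType k d v ∧ (∀ a ∈ IntermediateField.adjoin k ((S : Set K) \ {y}), v.val a = 0) ∧
      v.val (y - L) = 1 := by
    have : Infinite (IntermediateField.adjoin k ((S : Set K) \ {y})) :=
      Infinite.of_injective _ (algebraMap k _).injective
    simpa using (finite_setOf_not_isDivisorialType hd hS' (e ⟨0, h1⟩).2).exists_notMem
  obtain ⟨v, hvd, hv0, hv⟩ := hL
  refine ⟨y - L, ?_, ?_⟩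
  · rintro ⟨b, hb⟩
    have := hv0 _ (IntermediateField.algebraMap_mem _ b)
    rw [show algebraMap k K b = y - L from hb, hv] at this
    exact one_ne_zero this
  · rintro p hp - ⟨b, hb⟩
    have hb0 : b ≠ 0 := by
      rintro rfl
      rw [zero_pow hp.ne_zero] at hb
      simp [← hb, DiscreteValuation.val] at hv
    rw [← hb, v.val_pow hb0] at hv
    have := Int.isUnit_iff.mp (IsUnit.of_mul_eq_one _ hv)
    have := hp.one_lt
    omega

lemma K1proj_mem_iSup_of_isSeparableIn [IsAlgClosed k] [Algebra.EssFiniteType k K] {ℓ d : ℕ}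
    (hℓ : ℓ.Prime) (hd : HasTrdeg k K d) (h3 : 3 ≤ d) {a : Kˣ}
    (ha : (a : K) ∉ (⊥ : IntermediateField k K)) (hsep : IsSeparableIn K (a : K)) :
    K1proj ℓ K a ∈ ⨆ A ∈ {A : Subgroup (K1 ℓ K) | IsGoodRationalSubgroup ℓ k d A}, A := by
  obtain ⟨u, w, hu, hw, h⟩ := exists_isVeryGeneral_mul_eq hℓ hd h3 ha hsep
  have hmem : ∀ {u : K}, IsVeryGeneral ℓ k d u → ∀ hu0 : u ≠ 0, K1proj ℓ K (Units.mk0 u hu0) ∈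
      ⨆ A ∈ {A : Subgroup (K1 ℓ K) | IsGoodRationalSubgroup ℓ k d A}, A := fun {u} hu hu0 =>
    Subgroup.mem_iSup_of_mem (Omega ℓ k⟮u⟯) (Subgroup.mem_iSup_of_mem hu.2
      ⟨Units.mk0 u hu0, IntermediateField.mem_adjoin_simple_self k u, rfl⟩)
  have hu0 : u ≠ 0 := fun h0 => hu.1.1 (h0 ▸ zero_mem _)
  have hw0 : w ≠ 0 := fun h0 => hw.1.1 (h0 ▸ zero_mem _)
  have ha' : a = Units.mk0 u hu0 * Units.mk0 w hw0 := Units.ext h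
  rw [ha', map_mul]
  exact mul_mem (hmem hu hu0) (hmem hw hw0)

lemma mem_bot_pow [IsAlgClosed k] {n : ℕ} (hn : 0 < n) {a : K}
    (ha : a ∈ (⊥ : IntermediateField k K)) : ∃ b ∈ (⊥ : IntermediateField k K), b ^ n = a := by
  obtain ⟨b, rfl⟩ := ha
  obtain ⟨c, rfl⟩ := IsAlgClosed.exists_pow_nat_eq b hn
  exact ⟨algebraMap k K c, IntermediateField.algebraMap_mem _ _, (map_pow _ _ _).symm⟩

theorem iSup_isGoodRationalSubgroup_eq_top [IsAlgClosed k] [Algebra.EssFiniteType k K] {ℓ d : ℕ}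
    (hℓ : ℓ.Prime) (hd : HasTrdeg k K d) (h3 : 3 ≤ d) :
    (⨆ A ∈ {A : Subgroup (K1 ℓ K) | IsGoodRationalSubgroup ℓ k d A}, A) = ⊤ := by
  rw [eq_top_iff]
  intro q _
  obtain ⟨a, rfl⟩ := QuotientGroup.mk'_surjective _ q
  change K1proj ℓ K a ∈ _
  by_cases ha : (a : K) ∈ (⊥ : IntermediateField k K)
  · obtain ⟨b, -, hb⟩ := mem_bot_pow hℓ.pos ha
    have hb0 : b ≠ 0 := by
      rintro rfl
      exact a.ne_zero (by rw [← hb, zero_pow hℓ.ne_zero])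
    have h1 : K1proj ℓ K a = 1 :=
      (QuotientGroup.eq_one_iff a).mpr ⟨Units.mk0 b hb0, Units.ext hb⟩
    rw [h1]
    exact one_mem _
  by_cases hsep : IsSeparableIn K (a : K)
  · exact K1proj_mem_iSup_of_isSeparableIn hℓ hd h3 ha hsep
  obtain ⟨z, hz, hzsep⟩ := exists_isSeparableIn hd (by omega)
  have hz0 : z ≠ 0 := fun h => hz (h ▸ zero_mem _)
  simp only [IsSeparableIn, not_forall, not_not] at hsep
  obtain ⟨p, hp, hchar, b, hb⟩ := hsep
  have hb0 : b ≠ 0 := by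
    rintro rfl
    exact a.ne_zero (by rw [← hb, zero_pow hp.ne_zero])
  have hnot : ∀ c : K, c ^ p ≠ a * z := fun c hc => hzsep p hp hchar
    ⟨c / b, by rw [div_pow, hc, hb, mul_div_cancel_left₀ _ a.ne_zero]⟩
  have hprod := K1proj_mem_iSup_of_isSeparableIn hℓ hd h3 (a := a * Units.mk0 z hz0)
    (fun h => by
      obtain ⟨c, -, hc⟩ := mem_bot_pow hp.pos h
      exact hnot c hc)
    (fun q hq hqchar h => by
      obtain rfl := CharP.eq K hqchar hchar
      exact hnot _ h.choose_spec)
  have hzmem := K1proj_mem_iSup_of_isSeparableIn hℓ hd h3 (a := Units.mk0 z hz0) hz hzsep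
  rw [map_mul] at hprod
  exact (Subgroup.mul_mem_cancel_right _ hzmem).mp hprod

end main

theorem statement_16 (ℓ : ℕ) (hℓ : ℓ.Prime) (k K : Type*) [Field k] [Field K] [Algebra k K]
    [IsAlgClosed k] (hchar : ringChar k ≠ ℓ) (hK : IsFunctionField k K)
    (d : ℕ) (hd : HasTrdeg k K d) (h5 : 5 ≤ d) :
    (∀ x : K, x ≠ 0 → x ∉ (⊥ : IntermediateField k K) → IsSeparableIn K x →
      ∃ u w : K, IsVeryGeneral ℓ k d u ∧ IsVeryGeneral ℓ k d w ∧ x = u * w) ∧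
    (⨆ A ∈ {A : Subgroup (K1 ℓ K) | IsGoodRationalSubgroup ℓ k d A}, A) = ⊤ := by
  have : Algebra.EssFiniteType k K := IntermediateField.fg_top_iff.mp hK
  exact ⟨fun x _ hx hsep => exists_isVeryGeneral_mul_eq hℓ hd (by omega) hx hsep,
    iSup_isGoodRationalSubgroup_eq_top hℓ hd (by omega)⟩

end
end

section
/- Let ℓ be a prime and let K be a function field over an algebraically closed field k with char k ≠ ℓ and trdeg(K|k) ≥ 5. Let Φ be a group automorphism of K^×/(K^×)^ℓ such that Φ(Ω_K(F)) = Ω_K(F) for every relatively algebraically closed subextension F of K|k with trdeg(F|k) = 1. Then there exists ε ∈ (ℤ/ℓ)^× such that Φ(x) = x^ε for all x ∈ K^×/(K^×)^ℓ. -/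
/-! Common definitions: mod-ℓ Milnor K-theory, K^×/(K^×)^ℓ, Ω_K, relative algebraic
closure, transcendence degree predicates, discrete valuations, etc. -/

noncomputable section

open scoped TensorProduct

universe u v

open Polynomial IntermediateField in
/-- A simple transcendental extension `k(t)` of an algebraically closed field `k` is algebraically
closed in `L(t)` for every extension `L` of `k`. -/
lemma mem_adjoin_simple_of_isAlgebraic {k L K : Type*} [Field k] [Field L] [Field K]
    [Algebra k L] [Algebra L K] [Algebra k K] [IsScalarTower k L K] [IsAlgClosed k]
    {t α : K} (ht : Transcendental L t) (hα : α ∈ L⟮t⟯) (halg : IsAlgebraic k⟮t⟯ α) :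
    α ∈ k⟮t⟯ := by
  let _ : Algebra k[X] L[X] := Polynomial.algebra k L
  let _ : Algebra k[X] K := (aeval (R := k) t).toAlgebra
  let _ : Algebra L[X] K := (aeval (R := L) t).toAlgebra
  have hk : ∀ p : k[X], algebraMap k[X] K p = aeval t p := fun _ ↦ rfl
  have hL : ∀ p : L[X], algebraMap L[X] K p = aeval t p := fun _ ↦ rfl
  have : IsScalarTower k[X] L[X] K := .of_algebraMap_eq fun p ↦ by
    rw [hk, hL, algebraMap_def, coe_mapRingHom, aeval_map_algebraMap]
  have hinj : Function.Injective (algebraMap L[X] K) :=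
    transcendental_iff_injective.mp ht
  have : FaithfulSMul L[X] K := (faithfulSMul_iff_algebraMap_injective _ _).mpr hinj
  let _ : Algebra k[X] k⟮t⟯ := (aeval (R := k) (AdjoinSimple.gen k t)).toAlgebra
  have : IsScalarTower k[X] k⟮t⟯ K := .of_algebraMap_eq fun p ↦ by
    rw [hk, IntermediateField.algebraMap_apply]
    change _ = k⟮t⟯.val (aeval (AdjoinSimple.gen k t) p)
    rw [← aeval_algHom_apply]; rfl
  have hfrac : ∀ x ∈ k⟮t⟯, ∃ r s : k[X], x = aeval t r / aeval t s :=
    fun x hx ↦ (mem_adjoin_simple_iff k x).mp hx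
  have htk : Transcendental k t := ht.restrictScalars (algebraMap k L).injective
  have hinjk : Function.Injective (algebraMap k[X] K) := transcendental_iff_injective.mp htk
  have : Algebra.IsAlgebraic k[X] k⟮t⟯ := ⟨fun x ↦ by
    obtain ⟨r, s, h⟩ := hfrac x x.2
    have : IsAlgebraic k[X] (algebraMap k⟮t⟯ K x) := by
      rw [IntermediateField.algebraMap_apply, h, ← hk, ← hk, div_eq_mul_inv]
      exact (isAlgebraic_algebraMap r).mul (isAlgebraic_algebraMap s).inv
    exact (isAlgebraic_algebraMap_iff (algebraMap k⟮t⟯ K).injective).mp this⟩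
  have halg' : IsAlgebraic k[X] α := halg.restrictScalars k[X]
  obtain ⟨d, hd, hint⟩ := halg'.exists_integral_multiple
  let _ : Algebra (FractionRing L[X]) K := FractionRing.liftAlgebra L[X] K
  have := FractionRing.isScalarTower_liftAlgebra L[X] K
  have hdα : d • α = aeval t d * α := Algebra.smul_def _ _
  obtain ⟨r, s, hrs⟩ := (mem_adjoin_simple_iff L α).mp hα
  have hmem : d • α = algebraMap (FractionRing L[X]) K
      (algebraMap L[X] _ (algebraMap k[X] L[X] d * r) / algebraMap L[X] _ s) := by
    rw [map_div₀, ← IsScalarTower.algebraMap_apply, ← IsScalarTower.algebraMap_apply, map_mul,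
      ← IsScalarTower.algebraMap_apply, hdα, hrs, hk, hL, hL, mul_div_assoc]
  have hint' : IsIntegral L[X] (d • α) := hint.tower_top
  rw [hmem, isIntegral_algebraMap_iff (algebraMap (FractionRing L[X]) K).injective,
    IsIntegrallyClosed.isIntegral_iff] at hint'
  obtain ⟨P, hP⟩ := hint'
  rw [hmem, ← hP, ← IsScalarTower.algebraMap_apply, isIntegral_algebraMap_iff hinj,
    Polynomial.isIntegral_iff_isIntegral_coeff] at hint
  have hlift : P ∈ Polynomial.lifts (algebraMap k L) := by
    rw [Polynomial.lifts_iff_coeff_lifts]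
    intro n
    exact IsAlgClosed.algebraMap_bijective_of_isIntegral (k := k)
      (K := integralClosure k L) |>.2 ⟨_, hint n⟩ |>.imp fun x hx ↦ congrArg Subtype.val hx
  obtain ⟨Q, hQ⟩ := (mem_lifts _).mp hlift
  have hval : aeval t d * α = aeval t Q := by
    rw [← hdα, hmem, ← hP, ← IsScalarTower.algebraMap_apply, hL, ← hQ, aeval_map_algebraMap]
  have hd0 : aeval t d ≠ 0 := fun h ↦ hd (hinjk (by rw [hk, h, map_zero]))
  rw [mem_adjoin_simple_iff]
  exact ⟨Q, d, by rw [← hval, mul_div_cancel_left₀ _ hd0]⟩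

open Polynomial IntermediateField in
/-- If `A H = r ^ ℓ G` in `E(t)` with `H`, `G` not vanishing at `c`, then `ℓ` divides the order of
vanishing of `A` at `c`. -/
lemma dvd_rootMultiplicity {E K : Type*} [Field E] [Field K] [Algebra E K] {ℓ : ℕ} {t r : K}
    (ht : Transcendental E t) {A H G : E[X]} {c : E} (hr : r ∈ E⟮t⟯) (hA : A ≠ 0)
    (hH : H.eval c ≠ 0) (hG : G.eval c ≠ 0)
    (h : aeval t A * aeval t H = r ^ ℓ * aeval t G) : ℓ ∣ A.rootMultiplicity c := by
  classical
  obtain ⟨N, D, rfl⟩ := (mem_adjoin_simple_iff E r).mp hr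
  have hinj : Function.Injective (aeval (R := E) t) := transcendental_iff_injective.mp ht
  have hne : ∀ p : E[X], p ≠ 0 → aeval t p ≠ 0 := fun p hp h0 ↦ hp (hinj (by rw [h0, map_zero]))
  have hH0 : H ≠ 0 := by rintro rfl; simp at hH
  have hG0 : G ≠ 0 := by rintro rfl; simp at hG
  have hl : aeval t A * aeval t H ≠ 0 := mul_ne_zero (hne _ hA) (hne _ hH0)
  rcases Nat.eq_zero_or_pos ℓ with rfl | hℓ
  · have : A * H = G := hinj (by simpa using h)
    rw [zero_dvd_iff, rootMultiplicity_eq_zero]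
    rw [← this, eval_mul] at hG
    exact fun h0 ↦ hG (by rw [h0.eq_zero, zero_mul])
  have hr0 : (aeval t N / aeval t D) ^ ℓ ≠ 0 := fun h0 ↦ hl (by rw [h, h0, zero_mul])
  have hr1 := (pow_ne_zero_iff hℓ.ne').mp hr0
  have hD : D ≠ 0 := by rintro rfl; simp at hr1
  have hN : N ≠ 0 := by rintro rfl; simp at hr1
  have key : A * H * D ^ ℓ = N ^ ℓ * G := hinj (by
    have := hne _ hD
    simp only [map_mul, map_pow]
    rw [h, div_pow]
    field_simp)
  have e := congrArg (rootMultiplicity c) key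
  rw [rootMultiplicity_mul (by positivity), rootMultiplicity_mul (by positivity),
    rootMultiplicity_mul (by positivity), ← count_roots (p := D ^ ℓ), ← count_roots (p := N ^ ℓ),
    roots_pow, roots_pow, Multiset.count_nsmul, Multiset.count_nsmul,
    rootMultiplicity_eq_zero hH, rootMultiplicity_eq_zero hG, add_zero, add_zero] at e
  exact (Nat.dvd_add_left (dvd_mul_right ℓ _)).mp (e ▸ dvd_mul_right ℓ _)

open Polynomial in
/-- A polynomial over an algebraically closed field all of whose nonzero roots have multiplicity
divisible by `ℓ` is a power of `X` times an `ℓ`-th power. -/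
lemma exists_eq_X_pow_mul_pow {k : Type*} [Field k] [IsAlgClosed k] {ℓ : ℕ} (hℓ : 0 < ℓ)
    (P : k[X]) (h : ∀ c ≠ 0, ℓ ∣ P.rootMultiplicity c) :
    ∃ (n : ℕ) (Q : k[X]), P = X ^ n * Q ^ ℓ := by
  classical
  obtain ⟨e, he⟩ := IsAlgClosed.exists_pow_nat_eq P.leadingCoeff hℓ
  have hP : P = C P.leadingCoeff * ∏ c ∈ P.roots.toFinset, (X - C c) ^ P.rootMultiplicity c := by
    conv_lhs => rw [(IsAlgClosed.splits P).eq_prod_roots]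
    rw [prod_multiset_root_eq_finset_root]
  refine ⟨P.rootMultiplicity 0, C e * ∏ c ∈ P.roots.toFinset.erase 0,
    (X - C c) ^ (P.rootMultiplicity c / ℓ), ?_⟩
  rw [mul_pow, ← C_pow, he, ← Finset.prod_pow, mul_left_comm]
  conv_lhs => rw [hP]
  congr 1
  have h1 : ∏ c ∈ P.roots.toFinset.erase 0, ((X - C c) ^ (P.rootMultiplicity c / ℓ)) ^ ℓ =
      ∏ c ∈ P.roots.toFinset.erase 0, (X - C c) ^ P.rootMultiplicity c :=
    Finset.prod_congr rfl fun c hc ↦ by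
      rw [← pow_mul, Nat.div_mul_cancel (h c (Finset.ne_of_mem_erase hc))]
  rw [h1]
  by_cases h0 : (0 : k) ∈ P.roots.toFinset
  · rw [← Finset.mul_prod_erase _ _ h0, C_0, sub_zero]
  · rw [Finset.erase_eq_of_notMem h0, ← count_roots, Multiset.count_eq_zero.mpr (by simpa using h0),
      pow_zero, one_mul]

open Polynomial in
/-- Among infinitely many radicals of exponent `ℓ` in an algebraic extension of `M` having finitely
many `M`-embeddings, two differ by an element of `M`. -/
lemma exists_ne_div_mem_range {ι M K : Type*} [Infinite ι] [Field M] [Field K] [Algebra M K]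
    [FiniteDimensional M K] {ℓ : ℕ} (hℓ : (ℓ : M) ≠ 0) (r : ι → K) (hr0 : ∀ i, r i ≠ 0)
    (hr : ∀ i, r i ^ ℓ ∈ (algebraMap M K).range) :
    ∃ i j, i ≠ j ∧ r i / r j ∈ (algebraMap M K).range := by
  have hℓ0 : 0 < ℓ := Nat.pos_of_ne_zero (by rintro rfl; simp at hℓ)
  let Ω := AlgebraicClosure M
  let σ₀ : K →ₐ[M] Ω := IsAlgClosed.lift
  have hfin : Finite {z : Ω // z ^ ℓ = 1} := by
    refine Set.Finite.to_subtype (s := {z : Ω | z ^ ℓ = 1}) ?_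
    refine (nthRootsFinset ℓ (1 : Ω)).finite_toSet.subset fun z hz ↦ ?_
    exact (mem_nthRootsFinset hℓ0 _).mpr hz
  have hpow : ∀ (σ : K →ₐ[M] Ω) i, (σ (r i) / σ₀ (r i)) ^ ℓ = 1 := fun σ i ↦ by
    obtain ⟨m, hm⟩ := hr i
    have h0 : σ₀ (r i) ^ ℓ ≠ 0 := pow_ne_zero _ ((map_ne_zero σ₀).mpr (hr0 i))
    rw [div_pow, div_eq_one_iff_eq h0, ← map_pow, ← map_pow, ← hm, AlgHom.commutes,
      AlgHom.commutes]
  obtain ⟨i, j, hij, hf⟩ := Finite.exists_ne_map_eq_of_infinite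
    (fun i ↦ fun σ : K →ₐ[M] Ω ↦ (⟨σ (r i) / σ₀ (r i), hpow σ i⟩ : {z : Ω // z ^ ℓ = 1}))
  refine ⟨i, j, hij, ?_⟩
  have hfix : ∀ σ : K →ₐ[M] Ω, σ (r i / r j) = σ₀ (r i / r j) := fun σ ↦ by
    have h1 : σ (r i) / σ₀ (r i) = σ (r j) / σ₀ (r j) := congrArg Subtype.val (congrFun hf σ)
    have h2 := (map_ne_zero σ₀).mpr (hr0 i)
    have h3 := (map_ne_zero σ₀).mpr (hr0 j)
    have h4 := (map_ne_zero σ).mpr (hr0 j)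
    rw [div_eq_div_iff h2 h3] at h1
    rw [map_div₀, map_div₀, div_eq_div_iff h4 h3, h1, mul_comm]
  obtain ⟨a, ha⟩ := hr i
  obtain ⟨b, hb⟩ := hr j
  have hx : (r i / r j) ^ ℓ = algebraMap M K (a / b) := by rw [div_pow, ← ha, ← hb, map_div₀]
  have hab : a / b ≠ 0 := fun h ↦ by
    rw [h, map_zero] at hx
    exact div_ne_zero (hr0 i) (hr0 j) (pow_eq_zero_iff hℓ0.ne' |>.mp hx)
  have hsep : IsSeparable M (r i / r j) :=
    (separable_X_pow_sub_C (a / b) hℓ hab).of_dvd (minpoly.dvd _ _ (by simp [hx]))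
  classical
  have hint : IsIntegral M (r i / r j) := hsep.isIntegral
  have hroots : ((minpoly M (r i / r j)).map (algebraMap M Ω)).roots.toFinset ⊆
      {σ₀ (r i / r j)} := fun y hy ↦ by
    rw [Multiset.mem_toFinset, mem_roots', IsRoot.def, eval_map_algebraMap] at hy
    obtain ⟨σ, hσ⟩ := IntermediateField.exists_algHom_of_splits_of_aeval (F := M) (E := K) (K := Ω)
      (fun x ↦ ⟨Algebra.IsIntegral.isIntegral x, IsAlgClosed.splits _⟩) hy.2
    rw [Finset.mem_singleton, ← hσ, hfix]
  have hcard := Finset.card_le_card hroots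
  rw [Finset.card_singleton, Multiset.toFinset_card_of_nodup
    (nodup_roots (Separable.map hsep)), ← (IsAlgClosed.splits _).natDegree_eq_card_roots,
    natDegree_map] at hcard
  exact minpoly.natDegree_eq_one_iff.mp (le_antisymm hcard (minpoly.natDegree_pos hint))

/-- The pair `x, y` is not contained in the algebraic closure of any `E(p)`. -/
def IndepPair (E : Type*) {K : Type*} [Field E] [Field K] [Algebra E K] (x y : K) : Prop :=
  ∀ p : K, ¬ (IsAlgebraic (IntermediateField.adjoin E {p}) x ∧
    IsAlgebraic (IntermediateField.adjoin E {p}) y)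

open IntermediateField in
lemma IndepPair.transcendental_adjoin {E K : Type*} [Field E] [Field K] [Algebra E K] {x y p q : K}
    (h : IndepPair E x y) (hx : x ∈ adjoin E {p, q}) (hy : y ∈ adjoin E {p, q}) :
    Transcendental E⟮p⟯ q := fun hq ↦ by
  have hle : adjoin E {p, q} ≤ (algebraicClosure E⟮p⟯ K).restrictScalars E := by
    rw [adjoin_le_iff]
    rintro z (rfl | rfl)
    · exact IntermediateField.algebraMap_mem (algebraicClosure E⟮z⟯ K) ⟨z, mem_adjoin_simple_self E z⟩
    · exact mem_algebraicClosure_iff.mpr hq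
  exact h p ⟨mem_algebraicClosure_iff.mp (hle hx), mem_algebraicClosure_iff.mp (hle hy)⟩

lemma IndepPair.transcendental {E K : Type*} [Field E] [Field K] [Algebra E K] {x y p q : K}
    (h : IndepPair E x y) (hx : x ∈ IntermediateField.adjoin E {p, q})
    (hy : y ∈ IntermediateField.adjoin E {p, q}) : Transcendental E q :=
  (h.transcendental_adjoin hx hy).restrictScalars (algebraMap E _).injective

open IntermediateField in
/-- A form of Bertini's theorem: in the pencil `n * (s + a)`, all but finitely many members `t`
have `k(t)` separably closed in `K`. -/
lemma finite_setOf_not_separably_closed {k E K : Type*} [Field k] [Field E] [Field K] [Algebra k E]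
    [Algebra E K] [Algebra k K] [IsScalarTower k E K] [IsAlgClosed k] {s n : K}
    (h : IndepPair E s n) [FiniteDimensional (adjoin E {s, n}) K] :
    {a : k | ∃ α : K, IsSeparable k⟮n * (s + algebraMap k K a)⟯ α ∧
      α ∉ k⟮n * (s + algebraMap k K a)⟯}.Finite := by
  set M := adjoin E {s, n} with hM
  set t : k → K := fun a ↦ n * (s + algebraMap k K a) with ht
  have hs : s ∈ M := subset_adjoin _ _ (by simp)
  have hn : n ∈ M := subset_adjoin _ _ (by simp)
  have hkM : ∀ (L : IntermediateField E K) (a : k), algebraMap k K a ∈ L := fun L a ↦ by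
    rw [IsScalarTower.algebraMap_apply k E K]
    exact L.algebraMap_mem _
  have htM : ∀ a, t a ∈ M := fun a ↦ mul_mem hn (add_mem hs (hkM _ _))
  have hn0 : n ≠ 0 := fun hn0 ↦ h s ⟨isAlgebraic_algebraMap (⟨s, mem_adjoin_simple_self E s⟩ : E⟮s⟯),
    hn0 ▸ isAlgebraic_zero⟩
  let S := separableClosure M K
  have hfin : Finite (IntermediateField M S) :=
    Field.finite_intermediateField_of_exists_primitive_element M S
      (Field.exists_primitive_element M S)
  let N : k → IntermediateField M S := fun a ↦ adjoin M {β : S | IsSeparable k⟮t a⟯ (β : K)}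
  by_contra hinf
  obtain ⟨a, ⟨α, hα, hαn⟩, b, -, hab, hN⟩ := Set.Infinite.exists_ne_map_eq_of_mapsTo
    (f := N) (t := Set.univ) hinf (fun _ _ ↦ Set.mem_univ _) Set.finite_univ
  have hle : ∀ a, k⟮t a⟯ ≤ M.restrictScalars k := fun a ↦ by
    rw [adjoin_simple_le_iff]
    exact htM a
  have hαS : α ∈ S := by
    let _ : Algebra k⟮t a⟯ M := (inclusion (hle a)).toRingHom.toAlgebra
    have : IsScalarTower k⟮t a⟯ M K := .of_algebraMap_eq fun _ ↦ rfl
    exact mem_separableClosure_iff.mpr (hα.tower_top M)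
  have hmem : (⟨α, hαS⟩ : S) ∈ N b := hN ▸ subset_adjoin _ _ hα
  let L := algebraicClosure E⟮t b⟯ K
  have hba : algebraMap k K a - algebraMap k K b ≠ 0 :=
    sub_ne_zero.mpr fun e ↦ hab ((algebraMap k K).injective e)
  have hspan : ∀ F : IntermediateField E K, t a ∈ F → t b ∈ F → s ∈ F ∧ n ∈ F := fun F ha hb ↦ by
    have hn' : n ∈ F := by
      have : n = (t a - t b) / (algebraMap k K a - algebraMap k K b) := by
        rw [eq_div_iff hba, ht]; ring
      exact this ▸ div_mem (sub_mem ha hb) (sub_mem (hkM _ _) (hkM _ _))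
    refine ⟨?_, hn'⟩
    have : s = t a / n - algebraMap k K a := by
      rw [ht]; field_simp; ring
    exact this ▸ sub_mem (div_mem ha hn') (hkM _ _)
  have htb : t b ∈ L := L.algebraMap_mem ⟨t b, mem_adjoin_simple_self E _⟩
  have hML : M ≤ ((L⟮t a⟯).restrictScalars E⟮t b⟯).restrictScalars E := by
    obtain ⟨h1, h2⟩ := hspan (((L⟮t a⟯).restrictScalars E⟮t b⟯).restrictScalars E)
      (mem_adjoin_simple_self L _) (L⟮t a⟯.algebraMap_mem ⟨t b, htb⟩)
    rw [hM, adjoin_le_iff]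
    rintro z (rfl | rfl)
    exacts [h1, h2]
  have htr : Transcendental L (t a) := by
    obtain ⟨h1, h2⟩ := hspan (adjoin E {t b, t a}) (subset_adjoin _ _ (by simp))
      (subset_adjoin _ _ (by simp))
    exact (h.transcendental_adjoin h1 h2).algebraicClosure
  have hαL : α ∈ L⟮t a⟯ := by
    suffices ∀ β ∈ N b, (β : K) ∈ L⟮t a⟯ from this _ hmem
    intro β hβ
    induction hβ using adjoin_induction with
    | mem x hx =>
      have hx' : IsSeparable k⟮t b⟯ (x : K) := hx
      have hle' : k⟮t b⟯ ≤ E⟮t b⟯.restrictScalars k := by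
        rw [adjoin_simple_le_iff]
        exact mem_adjoin_simple_self E _
      let _ : Algebra k⟮t b⟯ E⟮t b⟯ := (inclusion hle').toRingHom.toAlgebra
      have : IsScalarTower k⟮t b⟯ E⟮t b⟯ K := .of_algebraMap_eq fun _ ↦ rfl
      have : IsAlgebraic E⟮t b⟯ (x : K) := (hx'.tower_top E⟮t b⟯).isIntegral.isAlgebraic
      exact L⟮t a⟯.algebraMap_mem ⟨x, mem_algebraicClosure_iff.mpr this⟩
    | algebraMap x => exact hML x.2
    | add x y _ _ hx hy => exact add_mem hx hy
    | mul x y _ _ hx hy => exact mul_mem hx hy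
    | inv x _ hx => exact inv_mem hx
  let _ : Algebra k L :=
    ((algebraMap E⟮t b⟯ L).comp ((algebraMap E E⟮t b⟯).comp (algebraMap k E))).toAlgebra
  have : IsScalarTower k L K := .of_algebraMap_eq (IsScalarTower.algebraMap_apply k E K)
  exact hαn (mem_adjoin_simple_of_isAlgebraic htr hαL hα.isIntegral.isAlgebraic)

lemma IsAlgebraic.of_forall_mem {F F' K : Type*} [Field F] [Field F'] [Field K] [Algebra F K]
    [Algebra F' K] {A : IntermediateField F K} {B : IntermediateField F' K}
    (hle : ∀ x ∈ A, x ∈ B) {α : K} (h : IsAlgebraic A α) : IsAlgebraic B α := by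
  let f : A →+* B := A.val.toRingHom.codRestrict B.toSubring fun x ↦ hle x x.2
  let _ : Algebra A B := f.toAlgebra
  have : IsScalarTower A B K := .of_algebraMap_eq fun _ ↦ rfl
  exact h.tower_top B

open IntermediateField in
lemma indepPair_of_transcendental {E K : Type*} [Field E] [Field K] [Algebra E K] {x y : K}
    (hx : Transcendental E x) (hy : Transcendental E⟮x⟯ y) : IndepPair E x y := fun p ⟨h1, h2⟩ ↦ by
  have hp : IsAlgebraic E⟮x⟯ p := by
    by_cases hp : IsAlgebraic E p
    · exact hp.tower_top _
    · exact isAlgebraic_adjoin_iff.mpr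
        (IsAlgebraic.adjoin_singleton (A := K) hp hx (isAlgebraic_adjoin_iff.mp h1))
  have hle : E⟮p⟯ ≤ (algebraicClosure E⟮x⟯ K).restrictScalars E := by
    rw [adjoin_simple_le_iff]
    exact mem_algebraicClosure_iff.mpr hp
  have h3 : IsAlgebraic (algebraicClosure E⟮x⟯ K) y := h2.of_forall_mem hle
  exact hy (h3.restrictScalars _)

open IntermediateField in
lemma exists_indepPair {k K : Type*} [Field k] [Field K] [Algebra k K] {x y : K}
    (hx : Transcendental k x) (hy : Transcendental k⟮x⟯ y) :
    ∃ E : IntermediateField k K, IndepPair E x y ∧ Algebra.IsAlgebraic (adjoin E {x, y}) K := by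
  have hy' : Transcendental (Algebra.adjoin k (id '' {x})) (id y) := by
    rw [Set.image_id]
    exact fun h ↦ hy (isAlgebraic_adjoin_iff.mpr h)
  have hx' : AlgebraicIndepOn k id {x} :=
    algebraicIndependent_unique_type_iff.mpr hx
  have hxy : y ≠ x := fun h ↦ hy (h ▸ isAlgebraic_algebraMap (⟨x, mem_adjoin_simple_self k x⟩ : k⟮x⟯))
  have hind := (AlgebraicIndepOn.insert_iff (by simpa using hxy)).mpr ⟨hx', hy'⟩
  obtain ⟨B, hB, hbas⟩ := exists_isTranscendenceBasis_superset hind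
  let B' := B \ {x, y}
  have hBB : B = insert y (insert x B') := by
    ext z
    have h1 : x ∈ B := hB (by simp)
    have h2 : y ∈ B := hB (by simp)
    simp only [B', Set.mem_insert_iff, Set.mem_sdiff, Set.mem_singleton_iff]
    grind
  have hi : AlgebraicIndepOn k id B := hbas.1
  rw [hBB, AlgebraicIndepOn.insert_iff (by simp [B', hxy]),
    AlgebraicIndepOn.insert_iff (by simp [B']), Set.image_id, Set.image_id] at hi
  refine ⟨adjoin k B', indepPair_of_transcendental
    (fun h ↦ hi.1.2 (isAlgebraic_adjoin_iff.mp h)) fun h ↦ hi.2 (isAlgebraic_adjoin_iff.mp ?_), ?_⟩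
  · refine h.of_forall_mem fun z hz ↦ ?_
    rw [← mem_restrictScalars k, adjoin_adjoin_left] at hz
    rwa [Set.insert_eq, Set.union_comm]
  · have := hbas.isAlgebraic_field
    refine ⟨fun z ↦ (this.isAlgebraic z).of_forall_mem fun w hw ↦ ?_⟩
    rw [← mem_restrictScalars k, adjoin_adjoin_left]
    rw [Subtype.range_coe, hBB] at hw
    convert hw using 2
    ext; simp; tauto

open IntermediateField Polynomial in
/-- If `k(t)` is separably closed in `K`, then modulo `ℓ`-th powers every element algebraic over
`k(t)` is a polynomial in `t`. -/
lemma exists_eq_aeval_mul_pow {k K : Type*} [Field k] [Field K] [Algebra k K] {ℓ : ℕ}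
    (hℓ : ℓ.Prime) (hchar : ringChar k ≠ ℓ) {t u : K} (hu : IsAlgebraic k⟮t⟯ u) (hu0 : u ≠ 0)
    (hsep : ∀ α : K, IsSeparable k⟮t⟯ α → α ∈ k⟮t⟯) :
    ∃ (P : k[X]) (w : K), u = aeval t P * w ^ ℓ := by
  obtain ⟨q, hq⟩ := ExpChar.exists k
  have : ExpChar k⟮t⟯ q := expChar_of_injective_algebraMap (algebraMap k k⟮t⟯).injective q
  obtain ⟨g, hg, m, hm⟩ := Irreducible.hasSeparableContraction q (minpoly.irreducible hu.isIntegral)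
  have hsepu : IsSeparable k⟮t⟯ (u ^ q ^ m) := by
    refine hg.of_dvd (minpoly.dvd _ _ ?_)
    rw [← expand_aeval, hm, minpoly.aeval]
  obtain ⟨r, s, hrs⟩ := (mem_adjoin_simple_iff k _).mp (hsep _ hsepu)
  have hcop : (q ^ m).Coprime ℓ := by
    refine Nat.Coprime.pow_left m ?_
    cases hq with
    | zero => simp
    | prime hq' =>
      rw [Nat.coprime_primes hq' hℓ]
      rintro rfl
      exact hchar (ringChar.eq k q)
  obtain ⟨c, -, hc⟩ := Nat.exists_mul_mod_eq_one_of_coprime hcop hℓ.one_lt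
  have hN : q ^ m * c = ℓ * (q ^ m * c / ℓ) + 1 := by rw [← hc]; exact (Nat.div_add_mod _ _).symm
  set d := q ^ m * c / ℓ
  have hs0 : aeval t s ≠ 0 := fun h ↦ by
    rw [h, div_zero] at hrs
    exact pow_ne_zero _ hu0 hrs
  refine ⟨r ^ c * s ^ (c * (ℓ - 1)), (aeval t s ^ c * u ^ d)⁻¹, ?_⟩
  have h1 : u * (u ^ d) ^ ℓ = aeval t r ^ c / aeval t s ^ c := by
    rw [← div_pow, ← hrs, ← pow_mul, ← pow_mul, hN, mul_comm d, pow_succ, mul_comm]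
  have h2 : (aeval t s ^ c) ^ ℓ = aeval t s ^ c * aeval t s ^ (c * (ℓ - 1)) := by
    rw [← pow_mul, ← pow_add]
    congr 1
    obtain ⟨e, rfl⟩ := Nat.exists_eq_succ_of_ne_zero hℓ.ne_zero
    simp; ring
  rw [map_mul, map_pow, map_pow, inv_pow, mul_pow, h2]
  have h3 : aeval t s ^ c ≠ 0 := pow_ne_zero _ hs0
  have h4 : aeval t s ^ (c * (ℓ - 1)) ≠ 0 := pow_ne_zero _ hs0
  have h5 : (u ^ d) ^ ℓ ≠ 0 := pow_ne_zero _ (pow_ne_zero _ hu0)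
  rw [eq_div_iff h3] at h1
  field_simp
  linear_combination h1

open Polynomial in
lemma aeval_aeval_ne_zero {k R : Type*} [Field k] [CommRing R] [Algebra k R] {m : R}
    (hm : Transcendental k m) {f Q : k[X]} (hf : f.natDegree ≠ 0) (hQ : Q ≠ 0) :
    aeval (aeval m f) Q ≠ 0 := by
  rw [← aeval_comp]
  refine transcendental_iff.mp hm _ |>.mt fun h ↦ ?_
  rw [comp_eq_zero_iff] at h
  rcases h with h | ⟨-, h⟩
  · exact hQ h
  · exact hf (h ▸ natDegree_C _)

open IntermediateField in
lemma IndepPair.pencil {k E K : Type*} [Field k] [Field E] [Field K] [Algebra k E]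
    [Algebra E K] [Algebra k K] [IsScalarTower k E K] {s m : K} (h : IndepPair E s m) (a : k) :
    Transcendental E⟮m⟯ (m * (s + algebraMap k K a)) ∧
      ∀ ρ ∈ adjoin E {s, m}, ρ ∈ E⟮m⟯⟮m * (s + algebraMap k K a)⟯ := by
  have hk : ∀ (L : IntermediateField E K), algebraMap k K a ∈ L := fun L ↦ by
    rw [IsScalarTower.algebraMap_apply k E K]
    exact L.algebraMap_mem _
  have hm0 : m ≠ 0 := fun hm0 ↦ h s ⟨isAlgebraic_algebraMap (⟨s, mem_adjoin_simple_self E s⟩ : E⟮s⟯),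
    hm0 ▸ isAlgebraic_zero⟩
  have hs : ∀ F : IntermediateField E K, m ∈ F → m * (s + algebraMap k K a) ∈ F → s ∈ F :=
    fun F h1 h2 ↦ by
      have : s = m * (s + algebraMap k K a) / m - algebraMap k K a := by field_simp; ring
      exact this ▸ sub_mem (div_mem h2 h1) (hk _)
  constructor
  · have h1 : m ∈ adjoin E {m, m * (s + algebraMap k K a)} := subset_adjoin _ _ (by simp)
    exact h.transcendental_adjoin (hs _ h1 (subset_adjoin _ _ (by simp))) h1
  · have hle : adjoin E {s, m} ≤
        E⟮m⟯⟮m * (s + algebraMap k K a)⟯.restrictScalars E := by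
      have h1 : m ∈ E⟮m⟯⟮m * (s + algebraMap k K a)⟯.restrictScalars E :=
        E⟮m⟯⟮m * (s + algebraMap k K a)⟯.algebraMap_mem ⟨m, mem_adjoin_simple_self E m⟩
      rw [adjoin_le_iff]
      rintro z (rfl | rfl)
      exacts [hs _ h1 (mem_adjoin_simple_self E⟮m⟯ _), h1]
    exact fun ρ hρ ↦ hle hρ

open IntermediateField Polynomial in
lemma finite_setOf_mul_add_eq_pow_mul {k E K : Type*} [Field k] [Field E] [Field K] [Algebra k E]
    [Algebra E K] [Algebra k K] [IsScalarTower k E K] {ℓ : ℕ} (hℓ : ℓ ≠ 1)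
    (hℓk : (ℓ : k) ≠ 0) {s m : K} (h : IndepPair E s m) [FiniteDimensional (adjoin E {s, m}) K]
    {y : K} : {a : k | ∃ r : K, m * (s + algebraMap k K a) = r ^ ℓ * y}.Finite := by
  set M := adjoin E {s, m} with hM
  by_contra hinf
  have : Infinite {a : k | ∃ r : K, m * (s + algebraMap k K a) = r ^ ℓ * y} :=
    Set.infinite_coe_iff.mpr hinf
  choose r hr using fun a : {a : k | ∃ r : K, m * (s + algebraMap k K a) = r ^ ℓ * y} ↦ a.2
  have ht : ∀ a : k, m * (s + algebraMap k K a) ≠ 0 := fun a h0 ↦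
    (h.pencil a).1 (h0 ▸ isAlgebraic_zero)
  have hℓ0 : ℓ ≠ 0 := by rintro rfl; simp at hℓk
  have hr0 : ∀ a, r a ≠ 0 := fun a h0 ↦ ht a (by rw [hr, h0, zero_pow hℓ0, zero_mul])
  have hy0 : y ≠ 0 := by
    rintro rfl
    exact ht _ ((hr (Classical.arbitrary _)).trans (mul_zero _))
  let o : {a : k | ∃ r : K, m * (s + algebraMap k K a) = r ^ ℓ * y} := Classical.arbitrary _
  have hkM : ∀ (L : IntermediateField E K) (a : k), algebraMap k K a ∈ L := fun L a ↦ by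
    rw [IsScalarTower.algebraMap_apply k E K]
    exact L.algebraMap_mem _
  have htM : ∀ a : k, m * (s + algebraMap k K a) ∈ M := fun a ↦
    mul_mem (subset_adjoin _ _ (by simp)) (add_mem (subset_adjoin _ _ (by simp)) (hkM _ _))
  have hℓM : (ℓ : M) ≠ 0 := fun e ↦
    hℓk ((algebraMap k E).injective ((algebraMap E M).injective (by simpa using e)))
  obtain ⟨a, b, hab, ⟨ρ, hρ⟩⟩ := exists_ne_div_mem_range hℓM (fun a ↦ r a / r o)
    (fun a ↦ div_ne_zero (hr0 a) (hr0 o)) fun a ↦ by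
      refine ⟨⟨_, div_mem (htM a) (htM o)⟩, ?_⟩
      change m * (s + algebraMap k K a) / (m * (s + algebraMap k K o)) = _
      rw [hr, hr, div_pow, mul_div_mul_right _ _ hy0]
  have hρ' : (ρ : K) = r a / r b := by
    rw [← div_div_div_cancel_right₀ (hr0 o)]
    exact hρ
  have : IsScalarTower k E⟮m⟯ K := .of_algebraMap_eq fun x ↦ by
    rw [IsScalarTower.algebraMap_apply k E E⟮m⟯, ← IsScalarTower.algebraMap_apply E E⟮m⟯ K,
      IsScalarTower.algebraMap_apply k E K]
  have hab' : (b : k) - a ≠ 0 := sub_ne_zero.mpr fun e ↦ hab (Subtype.ext e.symm)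
  have hm0 : m ≠ 0 := left_ne_zero_of_mul (ht a)
  obtain ⟨htr, hmem⟩ := h.pencil (a : k)
  let μ : E⟮m⟯ := ⟨m, mem_adjoin_simple_self E m⟩
  have hμ : μ ≠ 0 := fun e ↦ hm0 (congrArg Subtype.val e)
  have := dvd_rootMultiplicity (ℓ := ℓ) (A := X) (H := 1)
    (G := X + C (μ * algebraMap k _ ((b : k) - a))) (c := 0) htr (hmem ρ ρ.2) X_ne_zero
    (by simp) (by
      simp only [eval_add, eval_X, eval_C, zero_add]
      exact mul_ne_zero hμ ((_root_.map_ne_zero _).mpr hab')) (by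
      simp only [aeval_X, map_one, mul_one, map_add, aeval_C, map_mul]
      rw [← IsScalarTower.algebraMap_apply, map_sub, hρ', div_pow]
      change _ = _ * (_ + m * _)
      have : m * (s + algebraMap k K a) + m * (algebraMap k K b - algebraMap k K a) =
        m * (s + algebraMap k K b) := by ring
      rw [this, hr a, hr b]
      have := hr0 b
      field_simp)
  rw [← sub_zero (X : E⟮m⟯[X]), ← C_0, rootMultiplicity_X_sub_C_self, Nat.dvd_one] at this
  exact hℓ this

open IntermediateField Polynomial in
lemma finite_setOf_aeval_eq_pow_mul_aeval {k E K : Type*} [Field k] [Field E] [Field K] [Algebra k E]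
    [Algebra E K] [Algebra k K] [IsScalarTower k E K] [IsAlgClosed k] {ℓ : ℕ}
    (hℓk : (ℓ : k) ≠ 0) {s m : K} (h : IndepPair E s m) [FiniteDimensional (adjoin E {s, m}) K] :
    {a : k | ∃ (P Q : k[X]) (r : K), aeval (m * (s + algebraMap k K a)) P =
      r ^ ℓ * aeval (m ^ (ℓ + 1) * (s + algebraMap k K a)) Q ∧ P ≠ 0 ∧
        ¬ ∃ (n : ℕ) (R : k[X]), P = X ^ n * R ^ ℓ}.Finite := by
  set M := adjoin E {s, m} with hM
  have hℓ0 : ℓ ≠ 0 := by rintro rfl; simp at hℓk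
  set t : k → K := fun a ↦ m * (s + algebraMap k K a) with ht
  set t' : k → K := fun a ↦ m ^ (ℓ + 1) * (s + algebraMap k K a) with ht'
  by_contra hinf
  let S := {a : k | ∃ (P Q : k[X]) (r : K), aeval (t a) P = r ^ ℓ * aeval (t' a) Q ∧ P ≠ 0 ∧
        ¬ ∃ (n : ℕ) (R : k[X]), P = X ^ n * R ^ ℓ}
  have : Infinite S := Set.infinite_coe_iff.mpr hinf
  choose P Q r hr hP hPn using fun a : S ↦ a.2
  have htk : ∀ a : k, Transcendental k (t a) := fun a ↦
    ((h.pencil a).1.restrictScalars (algebraMap E E⟮m⟯).injective).restrictScalars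
      (algebraMap k E).injective
  have hP0 : ∀ a : S, aeval (t a) (P a) ≠ 0 := fun a h0 ↦
    hP a (transcendental_iff.mp (htk a) _ h0)
  have hr0 : ∀ a, r a ≠ 0 := fun a h0 ↦ hP0 a (by rw [hr, h0, zero_pow hℓ0, zero_mul])
  have hQ0 : ∀ a : S, aeval (t' a) (Q a) ≠ 0 := fun a h0 ↦ hP0 a (by rw [hr, h0, mul_zero])
  have hQ : ∀ a : S, Q a ≠ 0 := fun a h0 ↦ hQ0 a (by rw [h0, map_zero])
  have hkM : ∀ a : k, algebraMap k K a ∈ M := fun a ↦ by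
    rw [IsScalarTower.algebraMap_apply k E K]
    exact M.algebraMap_mem _
  have hmM : m ∈ M := subset_adjoin _ _ (by simp)
  have hsM : s ∈ M := subset_adjoin _ _ (by simp)
  have haeval : ∀ (F : k[X]) (z : K), z ∈ M → aeval z F ∈ M := fun F z hz ↦
    (Algebra.adjoin_le (S := (M.restrictScalars k).toSubalgebra) (by simpa using hz))
      (aeval_mem_adjoin_singleton k z)
  have hℓM : (ℓ : M) ≠ 0 := fun e ↦
    hℓk ((algebraMap k E).injective ((algebraMap E M).injective (by simpa using e)))
  obtain ⟨a, b, hab, ⟨ρ, hρ⟩⟩ := exists_ne_div_mem_range hℓM r hr0 fun a ↦ by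
      refine ⟨⟨_, div_mem (haeval (P a) (t a) (mul_mem hmM (add_mem hsM (hkM _))))
        (haeval (Q a) (t' a) (mul_mem (pow_mem hmM _) (add_mem hsM (hkM _))))⟩, ?_⟩
      change aeval (t a) (P a) / aeval (t' a) (Q a) = _
      rw [hr, mul_div_cancel_right₀ _ (hQ0 a)]
  have hρ' : (ρ : K) = r a / r b := hρ
  have : IsScalarTower k E⟮m⟯ K := .of_algebraMap_eq fun x ↦ by
    rw [IsScalarTower.algebraMap_apply k E E⟮m⟯, ← IsScalarTower.algebraMap_apply E E⟮m⟯ K,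
      IsScalarTower.algebraMap_apply k E K]
  have hab' : (b : k) - a ≠ 0 := sub_ne_zero.mpr fun e ↦ hab (Subtype.ext e.symm)
  obtain ⟨htr, hmem⟩ := h.pencil (a : k)
  let μ : E⟮m⟯ := ⟨m, mem_adjoin_simple_self E m⟩
  have hμm : algebraMap E⟮m⟯ K μ = m := rfl
  have hμ : Transcendental k μ := by
    have : Transcendental E m := h.transcendental (p := s) (subset_adjoin _ _ (by simp)) hmM
    have : Transcendental k (algebraMap E⟮m⟯ K μ) :=
      this.restrictScalars (algebraMap k E).injective
    exact (transcendental_algebraMap_iff (algebraMap E⟮m⟯ K).injective).mp this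
  let φ := algebraMap k E⟮m⟯
  have hdeg : ∀ (c d : k) (i j : ℕ), i < j → j ≠ 0 → d ≠ 0 →
      (C c * X ^ i + C d * X ^ j).natDegree ≠ 0 := fun c d i j hij hj hd h0 ↦ by
    have h1 := coeff_eq_zero_of_natDegree_lt (h0 ▸ Nat.pos_of_ne_zero hj)
    simp [hij.ne', hd] at h1
  refine hPn a (exists_eq_X_pow_mul_pow (Nat.pos_of_ne_zero hℓ0) _ fun c hc ↦ ?_)
  rw [eq_rootMultiplicity_map φ.injective]
  refine dvd_rootMultiplicity (ℓ := ℓ) (A := (P a).map φ)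
    (H := ((Q b).map φ).comp (C (μ ^ ℓ) * (X + C (μ * φ (b - a)))))
    (G := ((P b).map φ).comp (X + C (μ * φ (b - a))) * ((Q a).map φ).comp (C (μ ^ ℓ) * X))
    (c := φ c) htr (hmem ρ ρ.2) ((Polynomial.map_ne_zero_iff φ.injective).mpr (hP a)) ?_ ?_ ?_
  · have := aeval_aeval_ne_zero hμ (hdeg c (b - a) ℓ (ℓ + 1) (by simp) (by simp) hab') (hQ b)
    convert this using 1
    simp [eval_comp, φ]
    ring_nf
  · rw [eval_mul]
    refine mul_ne_zero ?_ ?_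
    · have := aeval_aeval_ne_zero hμ (hdeg c (b - a) 0 1 (by simp) (by simp) hab') (hP b)
      convert this using 1
      simp [eval_comp, φ]
      ring_nf
    · have := aeval_aeval_ne_zero hμ (hdeg 0 c 0 ℓ (by lia) hℓ0 hc) (hQ a)
      convert this using 1
      simp [eval_comp, φ]
      ring_nf
  · have e1 : t a + m * algebraMap k K (b - a) = t b := by rw [map_sub, ht]; ring
    have e2 : m ^ ℓ * t b = t' b := by rw [ht, ht']; ring
    have e3 : m ^ ℓ * t a = t' a := by rw [ht, ht']; ring
    simp only [map_mul, aeval_comp, map_add, aeval_X, aeval_C, map_pow, φ, aeval_map_algebraMap,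
      hμm]
    rw [← IsScalarTower.algebraMap_apply, e1, e3, e2, hr a, hr b, hρ', div_pow]
    have := hr0 b
    field_simp

lemma K1proj_eq_iff {ℓ : ℕ} {K : Type*} [Field K] {x y : Kˣ} :
    K1proj ℓ K x = K1proj ℓ K y ↔ ∃ z : Kˣ, x = y * z ^ ℓ := by
  rw [eq_comm, K1proj, QuotientGroup.mk'_apply, QuotientGroup.mk'_apply, QuotientGroup.eq]
  constructor
  · rintro ⟨z, hz⟩
    exact ⟨z, by rw [show z ^ ℓ = y⁻¹ * x from hz, mul_inv_cancel_left]⟩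
  · rintro ⟨z, rfl⟩
    exact ⟨z, by simp⟩

lemma K1_pow_eq_one {ℓ : ℕ} {K : Type*} [Field K] (x : K1 ℓ K) : x ^ ℓ = 1 := by
  obtain ⟨x, rfl⟩ := QuotientGroup.mk'_surjective _ x
  rw [← map_pow]
  exact (QuotientGroup.eq_one_iff _).mpr ⟨x, rfl⟩

open IntermediateField Polynomial in
lemma hasTrdeg_algebraicClosure_adjoin_simple {k K : Type*} [Field k] [Field K] [Algebra k K]
    {t : K} (ht : Transcendental k t) :
    HasTrdeg k ((algebraicClosure k⟮t⟯ K).restrictScalars k) 1 := by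
  let x : Fin 1 → k⟮t⟯ := fun _ ↦ AdjoinSimple.gen k t
  have hgen : Transcendental k (AdjoinSimple.gen k t) :=
    (transcendental_algebraMap_iff (algebraMap k⟮t⟯ K).injective).mp ht
  have hx : IsTranscendenceBasis k x := by
    refine isTranscendenceBasis_iff_algebraicIndependent_isAlgebraic.mpr
      ⟨algebraicIndependent_unique_type_iff.mpr hgen, ⟨fun y ↦ ?_⟩⟩
    obtain ⟨r, s, h⟩ := (mem_adjoin_simple_iff k _).mp y.2
    have hmem : ∀ p : k[X], aeval (AdjoinSimple.gen k t) p ∈ Algebra.adjoin k (Set.range x) :=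
      fun p ↦ Algebra.adjoin_mono (by rintro _ rfl; exact ⟨0, rfl⟩) (aeval_mem_adjoin_singleton k _)
    have hy : y = aeval (AdjoinSimple.gen k t) r / aeval (AdjoinSimple.gen k t) s := by
      refine Subtype.ext (h.trans ?_)
      change _ = k⟮t⟯.val (_ / _)
      rw [map_div₀, ← aeval_algHom_apply, ← aeval_algHom_apply]
      rfl
    rw [hy, div_eq_mul_inv]
    exact (isAlgebraic_algebraMap (⟨_, hmem r⟩ : Algebra.adjoin k (Set.range x))).mul
      (isAlgebraic_algebraMap (⟨_, hmem s⟩ : Algebra.adjoin k (Set.range x))).inv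
  have : FaithfulSMul k⟮t⟯ (algebraicClosure k⟮t⟯ K) :=
    (faithfulSMul_iff_algebraMap_injective _ _).mpr (algebraMap k⟮t⟯ _).injective
  have : NoZeroDivisors (algebraicClosure k⟮t⟯ K) := IsDomain.to_noZeroDivisors _
  exact ⟨_, hx.algebraMap_comp (A := algebraicClosure k⟮t⟯ K)⟩

open IntermediateField in
/-- `Φ` maps the class of an element algebraic over `k(t)` to the class of such an element. -/
lemma exists_isAlgebraic_of_map_Omega {ℓ : ℕ} {k K : Type*} [Field k] [Field K] [Algebra k K]
    {Φ : K1 ℓ K →* K1 ℓ K}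
    (hfix : ∀ F : IntermediateField k K, RelAlgClosed F → HasTrdeg k F 1 →
      (Omega ℓ F).map Φ = Omega ℓ F)
    {t : K} (ht : Transcendental k t) {u : Kˣ} (hu : IsAlgebraic k⟮t⟯ (u : K)) :
    ∃ v : Kˣ, IsAlgebraic k⟮t⟯ (v : K) ∧ Φ (K1proj ℓ K u) = K1proj ℓ K v := by
  let F := (algebraicClosure k⟮t⟯ K).restrictScalars k
  have hF : RelAlgClosed F := fun x hx ↦ by
    have hx' : IsAlgebraic (algebraicClosure k⟮t⟯ K) x := hx
    exact mem_algebraicClosure_iff.mpr (hx'.restrictScalars _)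
  have hmem : K1proj ℓ K u ∈ Omega ℓ F := ⟨u, mem_algebraicClosure_iff.mpr hu, rfl⟩
  have := Subgroup.mem_map_of_mem Φ hmem
  rw [hfix F hF (hasTrdeg_algebraicClosure_adjoin_simple ht)] at this
  obtain ⟨v, hv, hv'⟩ := this
  exact ⟨v, mem_algebraicClosure_iff.mp hv, hv'.symm⟩

open IntermediateField Polynomial in
/-- If `Φ` preserves the subgroups `Ω_K(F)` for `F` of transcendence degree one, then all but
finitely many members `w` of the pencil `m * (s + a)` have `Φ[w]` a power of `[w]`, and have class outside a
given finite set. -/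
lemma finite_setOf_map_notMem_zpowers {ℓ : ℕ} (hℓ : ℓ.Prime) {k K : Type*} [Field k] [Field K]
    [Algebra k K] [IsAlgClosed k] (hchar : ringChar k ≠ ℓ) [Algebra.EssFiniteType k K]
    {Φ : K1 ℓ K →* K1 ℓ K}
    (hfix : ∀ F : IntermediateField k K, RelAlgClosed F → HasTrdeg k F 1 →
      (Omega ℓ F).map Φ = Omega ℓ F)
    {s m : K} (hs : Transcendental k s) (hm : Transcendental k⟮s⟯ m) {T : Set (K1 ℓ K)}
    (hT : T.Finite) :
    {a : k | ∃ w : Kˣ, (w : K) = m * (s + algebraMap k K a) ∧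
      (Φ (K1proj ℓ K w) ∉ Subgroup.zpowers (K1proj ℓ K w) ∨ K1proj ℓ K w ∈ T)}.Finite := by
  obtain ⟨E, hE, halg⟩ := exists_indepPair hs hm
  have hℓk : (ℓ : k) ≠ 0 := fun h ↦ by
    have := ringChar.dvd h
    rcases (Nat.dvd_prime hℓ).mp this with h1 | h1
    · have := CharP.ringChar_ne_one (R := k)
      exact this h1
    · exact hchar h1
  have hfin : ∀ n : K, Algebra.IsAlgebraic (adjoin E {s, n}) K →
      FiniteDimensional (adjoin E {s, n}) K := fun n _ ↦ by
    have : Algebra.EssFiniteType E K := .of_comp k E K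
    have : Algebra.EssFiniteType (adjoin E {s, n}) K := .of_comp E _ K
    exact Algebra.finite_of_essFiniteType_of_isAlgebraic
  have hE' : IndepPair E s (m ^ (ℓ + 1)) := fun p ⟨h1, h2⟩ ↦ hE p ⟨h1, h2.of_pow ℓ.succ_pos⟩
  have halg' : Algebra.IsAlgebraic (adjoin E {s, m ^ (ℓ + 1)}) K := by
    have hle : adjoin E {s, m} ≤
        (algebraicClosure (adjoin E {s, m ^ (ℓ + 1)}) K).restrictScalars E := by
      rw [adjoin_le_iff]
      rintro z (rfl | rfl)
      · exact IntermediateField.algebraMap_mem (algebraicClosure (adjoin E {z, m ^ (ℓ + 1)}) K)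
          ⟨z, subset_adjoin _ _ (by simp)⟩
      · refine mem_algebraicClosure_iff.mpr (.of_pow ℓ.succ_pos ?_)
        exact isAlgebraic_algebraMap
          (⟨z ^ (ℓ + 1), subset_adjoin _ _ (by simp)⟩ : adjoin E {s, z ^ (ℓ + 1)})
    refine ⟨fun z ↦ ?_⟩
    have h3 : IsAlgebraic (algebraicClosure (adjoin E {s, m ^ (ℓ + 1)}) K) z :=
      (halg.isAlgebraic z).of_forall_mem hle
    exact h3.restrictScalars _
  have := hfin _ halg
  have := hfin _ halg'
  refine ((((finite_setOf_not_separably_closed (k := k) hE).union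
    (finite_setOf_not_separably_closed (k := k) hE')).union
    (finite_setOf_aeval_eq_pow_mul_aeval (k := k) hℓk hE)).union
    (hT.biUnion fun y _ ↦ finite_setOf_mul_add_eq_pow_mul (k := k) (y := (y.out : K))
      hℓ.ne_one hℓk hE)).subset ?_
  rintro a ⟨w, hw, h | h⟩
  swap
  · right
    refine Set.mem_biUnion h ?_
    obtain ⟨z, hz⟩ := K1proj_eq_iff.mp ((QuotientGroup.out_eq' (K1proj ℓ K w)).symm)
    have e := congrArg Units.val hz
    rw [Units.val_mul, Units.val_pow_eq_pow_val] at e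
    exact ⟨z, by rw [← hw, mul_comm]; exact e⟩
  left
  by_contra hbad
  simp only [Set.mem_union, Set.mem_ofPred_eq, not_or] at hbad
  obtain ⟨⟨h1, h2⟩, h3⟩ := hbad
  replace h1 := fun α hα ↦ not_not.mp fun hα' ↦ h1 ⟨α, hα, hα'⟩
  replace h2 := fun α hα ↦ not_not.mp fun hα' ↦ h2 ⟨α, hα, hα'⟩
  have hm0 : m ≠ 0 := fun h ↦ hm (h ▸ isAlgebraic_zero)
  have htr : Transcendental k (m * (s + algebraMap k K a)) :=
    ((hE.pencil a).1.restrictScalars (algebraMap E E⟮m⟯).injective).restrictScalars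
      (algebraMap k E).injective
  have htr' : Transcendental k (m ^ (ℓ + 1) * (s + algebraMap k K a)) :=
    ((hE'.pencil a).1.restrictScalars (algebraMap E E⟮m ^ (ℓ + 1)⟯).injective).restrictScalars
      (algebraMap k E).injective
  let w' := w * Units.mk0 m hm0 ^ ℓ
  have hw' : (w' : K) = m ^ (ℓ + 1) * (s + algebraMap k K a) := by
    simp [w', hw]; ring
  have hself : ∀ t : K, IsAlgebraic k⟮t⟯ t := fun t ↦
    isAlgebraic_algebraMap (⟨t, mem_adjoin_simple_self k t⟩ : k⟮t⟯)
  obtain ⟨v, hv, hΦv⟩ := exists_isAlgebraic_of_map_Omega hfix htr (u := w) (hw ▸ hself _)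
  obtain ⟨v', hv', hΦv'⟩ := exists_isAlgebraic_of_map_Omega hfix htr' (u := w') (hw' ▸ hself _)
  obtain ⟨P, z, hPz⟩ := exists_eq_aeval_mul_pow hℓ hchar hv v.ne_zero h1
  obtain ⟨Q, z', hQz⟩ := exists_eq_aeval_mul_pow hℓ hchar hv' v'.ne_zero h2
  have hww : K1proj ℓ K w' = K1proj ℓ K w := K1proj_eq_iff.mpr ⟨_, rfl⟩
  obtain ⟨y, hy⟩ := K1proj_eq_iff.mp (hΦv.symm.trans ((congrArg Φ hww.symm).trans hΦv'))
  have hz0 : z ≠ 0 := by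
    rintro rfl
    exact v.ne_zero (by rw [hPz, zero_pow hℓ.ne_zero, mul_zero])
  have hP0 : P ≠ 0 := by
    rintro rfl
    exact v.ne_zero (by rw [hPz, map_zero, zero_mul])
  have hPQ : aeval (m * (s + algebraMap k K a)) P =
      (z' * y / z) ^ ℓ * aeval (m ^ (ℓ + 1) * (s + algebraMap k K a)) Q := by
    have h4 : (v : K) = v' * y ^ ℓ := by rw [hy, Units.val_mul, Units.val_pow_eq_pow_val]
    rw [hPz, hQz] at h4
    rw [div_pow, mul_pow, div_mul_eq_mul_div, eq_div_iff (pow_ne_zero _ hz0)]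
    linear_combination h4
  obtain ⟨n, R, hR⟩ := not_not.mp fun hnR ↦ h3 ⟨P, Q, _, hPQ, hP0, hnR⟩
  have hvw : (v : K) = w ^ n * (aeval (w : K) R * z) ^ ℓ := by
    rw [hPz, hR, ← hw]
    simp only [map_mul, map_pow, aeval_X]
    ring
  have hRz : aeval (w : K) R * z ≠ 0 := fun h0 ↦
    v.ne_zero (by rw [hvw, h0, zero_pow hℓ.ne_zero, mul_zero])
  refine h (hΦv ▸ Subgroup.mem_zpowers_iff.mpr ⟨n, ?_⟩)
  rw [zpow_natCast, ← map_pow, eq_comm]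
  exact K1proj_eq_iff.mpr ⟨Units.mk0 _ hRz, Units.ext (by simpa using hvw)⟩

open IntermediateField in
lemma exists_forall_map_mem_zpowers {ℓ : ℕ} (hℓ : ℓ.Prime) {k K : Type*} [Field k] [Field K]
    [Algebra k K] [IsAlgClosed k] (hchar : ringChar k ≠ ℓ) [Algebra.EssFiniteType k K]
    {Φ : K1 ℓ K →* K1 ℓ K}
    (hfix : ∀ F : IntermediateField k K, RelAlgClosed F → HasTrdeg k F 1 →
      (Omega ℓ F).map Φ = Omega ℓ F)
    {s m : K} (hs : Transcendental k s) (hm : m ≠ 0) {T : Set (K1 ℓ K)} (hT : T.Finite)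
    {Z : Set Kˣ} (hZ : Z.Finite) (hmZ : ∀ z ∈ Z, Transcendental k⟮s⟯ (m * z)) :
    ∃ w : Kˣ, ∀ z ∈ Z, Φ (K1proj ℓ K (w * z)) ∈ Subgroup.zpowers (K1proj ℓ K (w * z)) ∧
      K1proj ℓ K (w * z) ∉ T := by
  have : Infinite k := IsAlgClosed.instInfinite
  obtain ⟨a, ha⟩ := (hZ.biUnion fun z hz ↦
    finite_setOf_map_notMem_zpowers hℓ hchar hfix hs (hmZ z hz) hT).infinite_compl.nonempty
  have hsa : s + algebraMap k K a ≠ 0 := fun h ↦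
    hs (eq_neg_of_add_eq_zero_left h ▸ (isAlgebraic_algebraMap a).neg)
  refine ⟨Units.mk0 _ (mul_ne_zero hm hsa), fun z hz ↦ ?_⟩
  by_contra hbad
  refine ha (Set.mem_biUnion hz ⟨_, ?_, by rwa [not_and_or, not_not] at hbad⟩)
  rw [Units.val_mul, Units.val_mk0]
  ring

lemma AlgebraicIndependent.exists_transcendental_adjoin {k K : Type*} [Field k] [Field K]
    [Algebra k K] {d : ℕ} {x : Fin d → K} (hx : AlgebraicIndependent k x) {S : Finset K}
    (hS : S.card < d) : ∃ m : K, Transcendental (IntermediateField.adjoin k (S : Set K)) m := by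
  by_contra! h
  have : Algebra.IsAlgebraic (Algebra.adjoin k (S : Set K)) K :=
    ⟨fun m ↦ IntermediateField.isAlgebraic_adjoin_iff.mp (not_not.mp (h m))⟩
  have h1 := Algebra.IsAlgebraic.trdeg_le_cardinalMk k (S : Set K)
  have h2 := hx.lift_cardinalMk_le_trdeg
  have h3 := h2.trans (Cardinal.lift_le.mpr h1)
  simp only [Cardinal.mk_fin, Cardinal.lift_natCast, SetLike.coe_sort_coe,
    Cardinal.mk_coe_finset] at h3
  have := Nat.cast_le.mp h3
  omega

/-- A homomorphism of a group of prime exponent which acts on `⟨g⟩` by `e` acts on `w` by `e`,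
provided that it preserves `⟨w⟩` and `⟨w * g⟩` and that `w` is not in `⟨g⟩`. -/
lemma map_eq_zpow_of_mem_zpowers {G : Type*} [CommGroup G] {ℓ : ℕ} (hℓ : ℓ.Prime)
    (hG : ∀ x : G, x ^ ℓ = 1) {φ : G →* G} {g w : G} {e : ℤ} (hg : g ≠ 1) (hφg : φ g = g ^ e)
    (hφw : φ w ∈ Subgroup.zpowers w) (hφwg : φ (w * g) ∈ Subgroup.zpowers (w * g))
    (hw : w ∉ Subgroup.zpowers g) : φ w = w ^ e := by
  obtain ⟨i, hi⟩ := Subgroup.mem_zpowers_iff.mp hφw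
  obtain ⟨j, hj⟩ := Subgroup.mem_zpowers_iff.mp hφwg
  have hrel : w ^ (i - j) = g ^ (j - e) := by
    rw [map_mul, ← hi, hφg, mul_zpow] at hj
    rw [zpow_sub, zpow_sub, mul_inv_eq_iff_eq_mul, mul_right_comm, eq_mul_inv_iff_mul_eq, ← hj,
      mul_comm]
  have hpow : ∀ (x : G) (n : ℤ), (ℓ : ℤ) ∣ n → x ^ n = 1 := by
    rintro x _ ⟨n, rfl⟩
    rw [zpow_mul, zpow_natCast, hG, one_zpow]
  have hcop : ∀ (x : G) (n : ℤ), ¬ (ℓ : ℤ) ∣ n → ∃ c : ℤ, (x ^ n) ^ c = x := fun x n hn ↦ by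
    obtain ⟨a, b, hab⟩ := ((Nat.prime_iff_prime_int.mp hℓ).coprime_iff_not_dvd.mpr hn)
    refine ⟨b, ?_⟩
    rw [← zpow_mul, mul_comm, ← one_mul (x ^ _), ← hpow x (a * ℓ) (dvd_mul_left _ _), ← zpow_add,
      hab, zpow_one]
  have hij : (ℓ : ℤ) ∣ i - j := by
    by_contra hij
    obtain ⟨c, hc⟩ := hcop w _ hij
    exact hw (Subgroup.mem_zpowers_iff.mpr ⟨(j - e) * c, by rw [zpow_mul, ← hrel, hc]⟩)
  have hje : (ℓ : ℤ) ∣ j - e := by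
    by_contra hje
    obtain ⟨c, hc⟩ := hcop g _ hje
    exact hg (by rw [← hc, ← hrel, hpow w _ hij, one_zpow])
  rw [← hi, ← sub_add_cancel i e, zpow_add, hpow w _ (by simpa using hij.add hje), one_mul]

lemma map_eq_zpow_of_map_mul {G : Type*} [CommGroup G] {φ : G →* G} {w x : G} {e : ℤ}
    (hw : φ w = w ^ e) (hwx : φ (w * x) = (w * x) ^ e) : φ x = x ^ e := by
  rw [map_mul, hw, mul_zpow] at hwx
  exact mul_left_cancel hwx

lemma zpow_eq_pow_val_intCast {G : Type*} [Group G] {ℓ : ℕ} [NeZero ℓ] {x : G} (hx : x ^ ℓ = 1)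
    (e : ℤ) : x ^ e = x ^ (e : ZMod ℓ).val := by
  rw [← zpow_natCast, ZMod.val_intCast]
  conv_lhs => rw [← Int.emod_add_mul_ediv e ℓ]
  rw [zpow_add, zpow_mul, zpow_natCast, hx, one_zpow, mul_one]

theorem statement_17 (ℓ : ℕ) (hℓ : ℓ.Prime) (k K : Type*) [Field k] [Field K] [Algebra k K]
    [IsAlgClosed k] (hchar : ringChar k ≠ ℓ) (hK : IsFunctionField k K)
    (htr : TrdegGe k K 5)
    (Φ : K1 ℓ K ≃* K1 ℓ K)
    (hfix : ∀ F : IntermediateField k K, RelAlgClosed F → HasTrdeg k F 1 →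
      (Omega ℓ F).map Φ.toMonoidHom = Omega ℓ F) :
    ∃ ε : (ZMod ℓ)ˣ, ∀ x : K1 ℓ K, Φ x = x ^ ((ε : ZMod ℓ)).val := by
  classical
  have : Fact ℓ.Prime := ⟨hℓ⟩
  have : Algebra.EssFiniteType k K := IntermediateField.fg_top_iff.mp hK
  obtain ⟨b, hb⟩ := htr
  have hs : Transcendental k (b 0) := hb.transcendental 0
  obtain ⟨m₀, hm₀⟩ := hb.exists_transcendental_adjoin (S := {b 0}) (by simp)
  rw [Finset.coe_singleton] at hm₀
  have hne : ∀ {F : IntermediateField k K} {m : K}, Transcendental F m → m ≠ 0 :=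
    fun hm h ↦ hm (h ▸ isAlgebraic_zero)
  obtain ⟨h, hh⟩ := exists_forall_map_mem_zpowers hℓ hchar hfix hs (hne hm₀)
    (Set.finite_singleton 1) (Set.finite_singleton 1) (by simpa using hm₀)
  obtain ⟨hΦh, hh1⟩ := hh 1 rfl
  rw [mul_one] at hΦh hh1
  obtain ⟨e, he⟩ := Subgroup.mem_zpowers_iff.mp hΦh
  have key : ∀ x : K1 ℓ K, Φ x = x ^ e := fun x ↦ by
    obtain ⟨x, rfl⟩ := QuotientGroup.mk'_surjective _ x
    change Φ (K1proj ℓ K x) = K1proj ℓ K x ^ e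
    obtain ⟨m, hm⟩ := hb.exists_transcendental_adjoin (S := {b 0, (h : K), (x : K)})
      (Finset.card_le_three.trans_lt (by norm_num))
    set L := IntermediateField.adjoin k ((({b 0, (h : K), (x : K)} : Finset K)) : Set K) with hL
    have hsub : ∀ y ∈ ({b 0, (h : K), (x : K)} : Finset K), y ∈ L := fun y hy ↦
      IntermediateField.subset_adjoin _ _ hy
    have hmz : ∀ z : Kˣ, (z : K) ∈ L → Transcendental (IntermediateField.adjoin k {b 0}) (m * z) :=
      fun z hz halg ↦ by
        have h1 : IsAlgebraic L (m * z) := halg.of_forall_mem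
          (IntermediateField.adjoin_simple_le_iff.mpr (hsub _ (by simp)))
        refine hm ?_
        have h2 := h1.mul (isAlgebraic_algebraMap (⟨(z : K), hz⟩ : L)).inv
        rwa [IntermediateField.algebraMap_apply, mul_assoc, mul_inv_cancel₀ z.ne_zero, mul_one] at h2
    have hhL : (h : K) ∈ L := hsub _ (by simp)
    have hxL : (x : K) ∈ L := hsub _ (by simp)
    have hfo : IsOfFinOrder (K1proj ℓ K h) :=
      isOfFinOrder_iff_pow_eq_one.mpr ⟨ℓ, hℓ.pos, K1_pow_eq_one _⟩
    obtain ⟨w, hw⟩ := exists_forall_map_mem_zpowers hℓ hchar hfix hs (hne hm)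
      (T := Subgroup.zpowers (K1proj ℓ K h)) (finite_zpowers.mpr hfo)
      (Set.toFinite {1, h, x, x * h}) (by
        rintro z (rfl | rfl | rfl | rfl)
        · exact hmz _ (by simp)
        · exact hmz _ hhL
        · exact hmz _ hxL
        · exact hmz _ (by rw [Units.val_mul]; exact mul_mem hxL hhL))
    have h1 := hw 1 (by simp)
    have h2 := hw h (by simp)
    have h3 := hw x (by simp)
    have h4 := hw (x * h) (by simp)
    rw [mul_one] at h1
    rw [map_mul] at h2
    rw [← mul_assoc, map_mul _ (w * x)] at h4
    have h5 := map_eq_zpow_of_mem_zpowers hℓ K1_pow_eq_one hh1 he.symm h1.1 h2.1 h1.2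
    have h6 := map_eq_zpow_of_mem_zpowers hℓ K1_pow_eq_one hh1 he.symm h3.1 h4.1 h3.2
    rw [map_mul] at h6
    exact map_eq_zpow_of_map_mul (G := K1 ℓ K) (φ := Φ.toMonoidHom) h5 h6
  have hval : ∀ x : K1 ℓ K, x ^ e = x ^ ((e : ZMod ℓ)).val :=
    fun x ↦ zpow_eq_pow_val_intCast (K1_pow_eq_one x) e
  have he0 : (e : ZMod ℓ) ≠ 0 := fun h0 ↦ hh1 (Φ.injective (by
    rw [key, hval, h0, ZMod.val_zero, pow_zero, map_one]))
  exact ⟨Units.mk0 _ he0, fun x ↦ (key x).trans (hval x)⟩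

end
end
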